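/- arXiv:2305.14013 — 2 statements merged into one kernel-verified Lean document; each statement's English description precedes it below -/
import Mathlib

section
/- The number of topological types of countable trees is exactly ℵ₁. Precisely: the quotient of the set of trees with vertex set ℕ by the equivalence relation ≡ (same topological type) has cardinality exactly ℵ₁. -/
universe u v

/-- A topological minor embedding of `H` into `G`: an injective map `toFun` on vertices
together with, for each edge of `H`, a path in `G` joining the images of its endpoints,
such that distinct edges get internally vertex-disjoint paths whose internal vertices
avoid the image of `toFun`. -/
structure TopMinorEmb {V : Type u} {W : Type v} (H : SimpleGraph V) (G : SimpleGraph W) where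
  toFun : V → W
  inj : Function.Injective toFun
  path : ∀ ⦃a b : V⦄, H.Adj a b → G.Walk (toFun a) (toFun b)
  path_isPath : ∀ ⦃a b : V⦄ (h : H.Adj a b), (path h).IsPath
  path_symm : ∀ ⦃a b : V⦄ (h : H.Adj a b), path h.symm = (path h).reverse
  internal_avoid_image : ∀ ⦃a b : V⦄ (h : H.Adj a b) (w : W),
      w ∈ (path h).support → w ≠ toFun a → w ≠ toFun b → ∀ x : V, toFun x ≠ w
  internally_disjoint : ∀ ⦃a b a' b' : V⦄ (h : H.Adj a b) (h' : H.Adj a' b'),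
      s(a, b) ≠ s(a', b') → ∀ w : W,
        w ∈ (path h).support → w ∈ (path h').support → w = toFun a ∨ w = toFun b

/-- `H ≤ G`: some subdivision of `H` embeds as a subgraph into `G`. -/
def TopMinorLE {V : Type u} {W : Type v} (H : SimpleGraph V) (G : SimpleGraph W) : Prop :=
  Nonempty (TopMinorEmb H G)

/-- `G ≡ H`: `G` and `H` have the same topological type. -/
def TopEquiv {V : Type u} {W : Type v} (G : SimpleGraph V) (H : SimpleGraph W) : Prop :=
  TopMinorLE G H ∧ TopMinorLE H G

/-! ### Infinite sets of natural numbers and arrays -/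

namespace BQO

/-- A function on infinite subsets of `A` whose value depends on a finite initial segment only. -/
def LocConst {α : Type*} (A : Set ℕ) (f : Set ℕ → α) : Prop :=
  ∀ X ⊆ A, X.Infinite → ∃ n, ∀ Y ⊆ A, Y.Infinite → (∀ i < n, i ∈ Y ↔ i ∈ X) → f Y = f X

/-- Removal of the least element. -/
def shift (X : Set ℕ) : Set ℕ := X \ {sInf X}

/-- `s` is an initial segment of `X`. -/
def Init (s : Finset ℕ) (X : Set ℕ) : Prop :=
  (∀ x ∈ s, x ∈ X) ∧ ∀ x ∈ X, x ∉ s → ∀ y ∈ s, y < x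

theorem shift_subset (X : Set ℕ) : shift X ⊆ X := Set.sdiff_subset

theorem infinite_shift {X : Set ℕ} (h : X.Infinite) : (shift X).Infinite :=
  h.sdiff (Set.finite_singleton _)

theorem LocConst.mono {α : Type*} {A B : Set ℕ} {f : Set ℕ → α} (h : LocConst A f)
    (hB : B ⊆ A) : LocConst B f := fun X hX hXi =>
  (h X (hX.trans hB) hXi).imp fun _ hn Y hY => hn Y (hY.trans hB)

theorem LocConst.comp {α β : Type*} {A : Set ℕ} {f : Set ℕ → α} (h : LocConst A f)
    (g : α → β) : LocConst A fun X => g (f X) := fun X hX hXi =>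
  (h X hX hXi).imp fun _ hn Y hY hYi hag => congrArg g (hn Y hY hYi hag)

theorem LocConst.prodMk {α β : Type*} {A : Set ℕ} {f : Set ℕ → α} {g : Set ℕ → β}
    (hf : LocConst A f) (hg : LocConst A g) : LocConst A fun X => (f X, g X) := by
  intro X hX hXi
  obtain ⟨n, hn⟩ := hf X hX hXi
  obtain ⟨m, hm⟩ := hg X hX hXi
  refine ⟨max n m, fun Y hY hYi hag => ?_⟩
  dsimp only
  rw [hn Y hY hYi fun i hi => hag i (lt_max_of_lt_left hi),
    hm Y hY hYi fun i hi => hag i (lt_max_of_lt_right hi)]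

theorem LocConst.comp_shift {α : Type*} {A : Set ℕ} {f : Set ℕ → α} (h : LocConst A f) :
    LocConst A fun X => f (shift X) := by
  intro X hX hXi
  obtain ⟨n, hn⟩ := h (shift X) ((shift_subset X).trans hX) (infinite_shift hXi)
  refine ⟨max n (sInf X + 1), fun Y hY hYi hag => ?_⟩
  have hmem : sInf X ∈ X := Nat.sInf_mem hXi.nonempty
  have hXY : sInf X ∈ Y := (hag _ (lt_max_of_lt_right (Nat.lt_succ_self _))).2 hmem
  have hle : sInf Y ≤ sInf X := Nat.sInf_le hXY
  have hYX : sInf Y ∈ X :=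
    (hag _ (lt_max_of_lt_right (Nat.lt_succ_of_le hle))).1 (Nat.sInf_mem hYi.nonempty)
  have heq : sInf Y = sInf X := le_antisymm hle (Nat.sInf_le hYX)
  refine hn _ ((shift_subset Y).trans hY) (infinite_shift hYi) fun i hi => ?_
  simp only [shift, Set.mem_sdiff, Set.mem_singleton_iff, heq,
    hag i (lt_max_of_lt_left hi)]

theorem Init.agree {s : Finset ℕ} {X Y : Set ℕ} (hX : Init s X) (hY : Init s Y) {y : ℕ}
    (hy : y ∈ s) : ∀ i < y, i ∈ Y ↔ i ∈ X := by
  intro i hi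
  by_cases his : i ∈ s
  · exact ⟨fun _ => hX.1 i his, fun _ => hY.1 i his⟩
  · constructor
    · intro h; exact absurd (hY.2 i h his y hy) (by omega)
    · intro h; exact absurd (hX.2 i h his y hy) (by omega)

theorem init_filter (X : Set ℕ) [DecidablePred (· ∈ X)] (m : ℕ) :
    Init ((Finset.range m).filter (· ∈ X)) X := by
  refine ⟨fun x hx => (Finset.mem_filter.1 hx).2, fun x hx hxs y hy => ?_⟩
  simp only [Finset.mem_filter, Finset.mem_range, not_and] at hxs hy
  by_contra hlt
  exact hxs (by omega) hx

open Classical in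
/-- Building an infinite set by end-extending finite sets one element at a time. -/
theorem exists_infinite_of_extend (A : Set ℕ) (Φ : Finset ℕ → Prop) (h0 : Φ ∅)
    (hs : ∀ F, Φ F → ∃ n ∈ A, (∀ x ∈ F, x < n) ∧ Φ (insert n F)) :
    ∃ B ⊆ A, B.Infinite ∧ ∀ m, Φ ((Finset.range m).filter (· ∈ B)) := by
  choose! e heA hlt hΦ using hs
  let F : ℕ → Finset ℕ := fun n => Nat.rec ∅ (fun _ G => insert (e G) G) n
  have hF1 : ∀ n, F (n + 1) = insert (e (F n)) (F n) := fun n => rfl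
  have hF : ∀ n, Φ (F n) := by
    intro n
    induction n with
    | zero => exact h0
    | succ n ih => rw [hF1]; exact hΦ _ ih
  have hmono : Monotone F := monotone_nat_of_le_succ fun n => by
    rw [hF1]; exact Finset.subset_insert _ _
  have hstrict : StrictMono fun n => e (F n) := strictMono_nat_of_lt_succ fun n =>
    hlt _ (hF (n + 1)) _ (by rw [hF1]; exact Finset.mem_insert_self _ _)
  have hmem : ∀ n x, x ∈ F n ↔ ∃ k < n, x = e (F k) := by
    intro n
    induction n with
    | zero => intro x; simp [F]
    | succ n ih =>
      intro x
      rw [hF1, Finset.mem_insert, ih]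
      constructor
      · rintro (h | ⟨k, hk, h⟩)
        · exact ⟨n, Nat.lt_succ_self n, h⟩
        · exact ⟨k, hk.trans (Nat.lt_succ_self n), h⟩
      · rintro ⟨k, hk, h⟩
        rcases Nat.lt_succ_iff_lt_or_eq.1 hk with hk | rfl
        · exact Or.inr ⟨k, hk, h⟩
        · exact Or.inl h
  refine ⟨Set.range fun n => e (F n), ?_, Set.infinite_range_of_injective hstrict.injective, ?_⟩
  · rintro _ ⟨n, rfl⟩; exact heA _ (hF n)
  · intro m
    have hex : ∃ n, m ≤ e (F n) := ⟨m, hstrict.le_apply⟩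
    have : (Finset.range m).filter (· ∈ Set.range fun n => e (F n)) = F (Nat.find hex) := by
      ext x
      rw [hmem, Finset.mem_filter, Finset.mem_range, Set.mem_range]
      constructor
      · rintro ⟨hx, k, rfl⟩
        refine ⟨k, ?_, rfl⟩
        by_contra hk
        have := hstrict.monotone (not_lt.1 hk)
        have := Nat.find_spec hex
        omega
      · rintro ⟨k, hk, rfl⟩
        exact ⟨not_le.1 (Nat.find_min hex hk), k, rfl⟩
    rw [this]
    exact hF _

/-- `P` holds for almost all end-extensions of `s`, in the sense of an iterated ultrafilter. -/
inductive AE (U : Ultrafilter ℕ) (A : Set ℕ) (P : Set ℕ → Prop) : Finset ℕ → Prop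
  | all (s : Finset ℕ) (h : ∀ X ⊆ A, X.Infinite → Init s X → P X) : AE U A P s
  | step (s : Finset ℕ) (S : Set ℕ) (hS : S ∈ U) (h : ∀ n ∈ S, AE U A P (insert n s)) : AE U A P s

variable {U : Ultrafilter ℕ} {A : Set ℕ} {P : Set ℕ → Prop}

theorem eventually_lt (hU : (U : Filter ℕ) ≤ Filter.cofinite) (F : Finset ℕ) :
    ∀ᶠ n in (U : Filter ℕ), ∀ x ∈ F, x < n := by
  refine (Filter.eventually_all_finset F).2 fun x _ => hU ?_
  rw [← Nat.cofinite_eq_atTop.symm]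
  exact Filter.eventually_gt_atTop x

theorem AE.eventually (hU : (U : Filter ℕ) ≤ Filter.cofinite) {s : Finset ℕ} (h : AE U A P s) :
    ∀ᶠ n in (U : Filter ℕ), AE U A P (insert n s) := by
  cases h with
  | all _ h =>
    filter_upwards [eventually_lt hU s] with n hn
    refine AE.all _ fun X hX hXi hin => h X hX hXi ?_
    refine ⟨fun x hx => hin.1 x (Finset.mem_insert_of_mem hx), fun x hx hxs y hy => ?_⟩
    by_cases hxn : x = n
    · rw [hxn]; exact hn y hy
    · exact hin.2 x hx (by simp [hxn, hxs]) y (Finset.mem_insert_of_mem hy)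
  | step _ S hS h => exact Filter.mem_of_superset hS h

theorem AE.not_not (hU : (U : Filter ℕ) ≤ Filter.cofinite) (hA : A ∈ U) {s : Finset ℕ}
    (hsA : ∀ x ∈ s, x ∈ A) (h : AE U A P s) : ¬ AE U A (fun X => ¬ P X) s := by
  induction h with
  | all s h =>
    intro h'
    have key : ∀ s, AE U A (fun X => ¬ P X) s → (∀ x ∈ s, x ∈ A) →
        (∀ X ⊆ A, X.Infinite → Init s X → P X) → False := by
      intro s hs
      induction hs with
      | all s h' =>
        intro hsA h
        have hAi : A.Infinite := fun hf => by
          have := hU hf.compl_mem_cofinite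
          exact Ultrafilter.compl_notMem_iff.2 hA this
        let X : Set ℕ := {x | x ∈ s ∨ (x ∈ A ∧ ∀ y ∈ s, y < x)}
        have hXA : X ⊆ A := by
          rintro x (hx | hx)
          · exact hsA x hx
          · exact hx.1
        have hXi : X.Infinite := by
          have : (A \ Set.Iic (s.sup id)).Infinite := hAi.sdiff (Set.finite_Iic _)
          refine this.mono ?_
          rintro x ⟨hx, hx'⟩
          refine Or.inr ⟨hx, fun y hy => ?_⟩
          have := Finset.le_sup (f := id) hy
          simp only [Set.mem_Iic, not_le, id] at hx' this
          omega
        have hin : Init s X := ⟨fun x hx => Or.inl hx, fun x hx hxs => (hx.resolve_left hxs).2⟩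
        exact h' X hXA hXi hin (h X hXA hXi hin)
      | step s S hS _ ih =>
        intro hsA h
        have : ∀ᶠ n in (U : Filter ℕ), n ∈ S ∧ n ∈ A ∧ ∀ x ∈ s, x < n :=
          (Filter.Eventually.and hS (Filter.Eventually.and hA (eventually_lt hU s)))
        obtain ⟨n, hnS, hnA, hn⟩ := this.exists
        refine ih n hnS (by simpa [hnA] using hsA) fun X hX hXi hin => h X hX hXi ?_
        refine ⟨fun x hx => hin.1 x (Finset.mem_insert_of_mem hx), fun x hx hxs y hy => ?_⟩
        by_cases hxn : x = n
        · rw [hxn]; exact hn y hy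
        · exact hin.2 x hx (by simp [hxn, hxs]) y (Finset.mem_insert_of_mem hy)
    exact key s h' hsA h
  | step s S hS _ ih =>
    intro h'
    have : ∀ᶠ n in (U : Filter ℕ), n ∈ S ∧ n ∈ A ∧ AE U A (fun X => ¬ P X) (insert n s) :=
      (Filter.Eventually.and hS (Filter.Eventually.and hA (h'.eventually hU)))
    obtain ⟨n, hnS, hnA, hn⟩ := this.exists
    exact ih n hnS (by simpa [hnA] using hsA) hn

open Classical in
theorem LocConst.exists_init {α : Type*} {f : Set ℕ → α} (h : LocConst A f) {X : Set ℕ}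
    (hX : X ⊆ A) (hXi : X.Infinite) :
    ∃ m, ∀ Y ⊆ A, Y.Infinite → Init ((Finset.range m).filter (· ∈ X)) Y → f Y = f X := by
  obtain ⟨n, hn⟩ := h X hX hXi
  obtain ⟨y, hyX, hy⟩ := hXi.exists_gt n
  refine ⟨y + 1, fun Y hY hYi hin => hn Y hY hYi fun i hi => ?_⟩
  exact (init_filter X (y + 1)).agree hin (y := y) (by simp [hyX]) i (hi.trans hy)

open Classical in
theorem AE.or_not (hU : (U : Filter ℕ) ≤ Filter.cofinite) (hA : A ∈ U) (hP : LocConst A P) :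
    AE U A P ∅ ∨ AE U A (fun X => ¬ P X) ∅ := by
  by_contra hcon
  obtain ⟨B, hBA, hBi, hB⟩ := exists_infinite_of_extend A
    (fun s => ¬ (AE U A P s ∨ AE U A (fun X => ¬ P X) s)) hcon (by
      intro F hF
      rw [not_or] at hF
      have h1 : ∀ᶠ n in (U : Filter ℕ), ¬ AE U A P (insert n F) :=
        Ultrafilter.eventually_not.2 fun h => hF.1 (AE.step _ _ h fun _ hn => hn)
      have h2 : ∀ᶠ n in (U : Filter ℕ), ¬ AE U A (fun X => ¬ P X) (insert n F) :=
        Ultrafilter.eventually_not.2 fun h => hF.2 (AE.step _ _ h fun _ hn => hn)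
      obtain ⟨n, h1, h2, h3, h4⟩ :=
        (h1.and (h2.and (Filter.Eventually.and hA (eventually_lt hU F)))).exists
      exact ⟨n, h3, h4, not_or.2 ⟨h1, h2⟩⟩)
  obtain ⟨m, hm⟩ := hP.exists_init hBA hBi
  refine hB m ?_
  by_cases hPB : P B
  · exact Or.inl (AE.all _ fun X hX hXi hin => (hm X hX hXi hin).symm ▸ hPB)
  · exact Or.inr (AE.all _ fun X hX hXi hin => (hm X hX hXi hin).symm ▸ hPB)

open Classical in
theorem AE.exists_homogeneous (hU : (U : Filter ℕ) ≤ Filter.cofinite) (hA : A ∈ U)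
    (hP : LocConst A P) (h : AE U A P ∅) :
    ∃ B ⊆ A, B.Infinite ∧ ∀ X ⊆ B, X.Infinite → P X := by
  obtain ⟨B, hBA, hBi, hB⟩ := exists_infinite_of_extend A
    (fun F => ∀ s ⊆ F, AE U A P s) (by simpa using h) (by
      intro F hF
      have h1 : ∀ᶠ n in (U : Filter ℕ), ∀ s ∈ F.powerset, AE U A P (insert n s) :=
        (Filter.eventually_all_finset _).2 fun s hs =>
          (hF s (Finset.mem_powerset.1 hs)).eventually hU
      obtain ⟨n, h1, h3, h4⟩ :=
        (h1.and (Filter.Eventually.and hA (eventually_lt hU F))).exists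
      refine ⟨n, h3, h4, fun s hs => ?_⟩
      by_cases hns : n ∈ s
      · rw [← Finset.insert_erase hns]
        exact h1 _ (Finset.mem_powerset.2 fun x hx =>
          (Finset.mem_insert.1 (hs (Finset.mem_of_mem_erase hx))).resolve_left
            (Finset.ne_of_mem_erase hx))
      · refine hF s fun x hx => (Finset.mem_insert.1 (hs hx)).resolve_left ?_
        rintro rfl; exact hns hx)
  refine ⟨B, hBA, hBi, fun X hX hXi => ?_⟩
  by_contra hPX
  obtain ⟨m, hm⟩ := hP.exists_init (hX.trans hBA) hXi
  refine AE.not_not hU hA ?_ (hB m ((Finset.range m).filter (· ∈ X)) ?_)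
    (AE.all _ fun Y hY hYi hin => (hm Y hY hYi hin).symm ▸ hPX)
  · intro x hx; exact hBA (hX (Finset.mem_filter.1 hx).2)
  · intro x hx
    rw [Finset.mem_filter] at hx ⊢
    exact ⟨hx.1, hX hx.2⟩

/-- The Nash-Williams partition theorem: locally constant colourings of the infinite subsets of
an infinite set are homogeneous on some infinite subset. -/
theorem LocConst.ramsey (hA : A.Infinite) (hP : LocConst A P) :
    ∃ B ⊆ A, B.Infinite ∧ ((∀ X ⊆ B, X.Infinite → P X) ∨ ∀ X ⊆ B, X.Infinite → ¬ P X) := by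
  have hne : (Filter.cofinite ⊓ Filter.principal A).NeBot := hA.cofinite_inf_principal_neBot
  let U : Ultrafilter ℕ := Ultrafilter.of (Filter.cofinite ⊓ Filter.principal A)
  have hle : (U : Filter ℕ) ≤ Filter.cofinite ⊓ Filter.principal A := Ultrafilter.of_le _
  have hU : (U : Filter ℕ) ≤ Filter.cofinite := hle.trans inf_le_left
  have hAU : A ∈ U := (hle.trans inf_le_right) (Filter.mem_principal_self A)
  rcases AE.or_not hU hAU hP with h | h
  · obtain ⟨B, h1, h2, h3⟩ := h.exists_homogeneous hU hAU hP
    exact ⟨B, h1, h2, Or.inl h3⟩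
  · obtain ⟨B, h1, h2, h3⟩ := h.exists_homogeneous hU hAU (hP.comp Not)
    exact ⟨B, h1, h2, Or.inr h3⟩

end BQO

namespace BQO

/-- `f` is a bad array on the infinite subsets of the infinite set `A`. -/
structure BadArray {α : Type*} (r : α → α → Prop) (A : Set ℕ) (f : Set ℕ → α) : Prop where
  infinite : A.Infinite
  locConst : LocConst A f
  bad : ∀ X ⊆ A, X.Infinite → ¬ r (f X) (f (shift X))

theorem BadArray.mono {α : Type*} {r : α → α → Prop} {A B : Set ℕ} {f : Set ℕ → α}
    (h : BadArray r A f) (hB : B ⊆ A) (hBi : B.Infinite) : BadArray r B f :=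
  ⟨hBi, h.locConst.mono hB, fun X hX => h.bad X (hX.trans hB)⟩

/-- The states of the construction of a minimal bad array. -/
structure MinState (α : Type*) where
  bound : ℕ
  carrier : Set ℕ
  arr : Set ℕ → α
  frozen : Set (Set ℕ)
  todo : List (Finset ℕ)

namespace MinState

variable {α : Type*} (r lt : α → α → Prop)

/-- The sets whose part below the current bound is `s`. -/
def nbhd (b : ℕ) (s : Finset ℕ) : Set (Set ℕ) := {X | ∀ i < b, i ∈ X ↔ i ∈ s}

/-- The array can be improved on all sets starting with `s`. -/
structure Improves (st : MinState α) (s : Finset ℕ) (D : Set ℕ) (h : Set ℕ → α) : Prop where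
  subset : D ⊆ st.carrier
  start : ∀ x ∈ st.carrier, x < st.bound → (x ∈ D ↔ x ∈ s)
  badArray : BadArray r D h
  le : ∀ X ⊆ D, X.Infinite → h X = st.arr X ∨ lt (h X) (st.arr X)
  frozen : ∀ X ⊆ D, X.Infinite → X ∈ st.frozen → h X = st.arr X
  lt : ∀ X ⊆ D, X.Infinite → X ∈ nbhd st.bound s → lt (h X) (st.arr X)

/-- One step of the construction. -/
structure Step (st st' : MinState α) : Prop where
  badArray : BadArray r st'.carrier st'.arr
  subset : st'.carrier ⊆ st.carrier
  keep : ∀ x ∈ st.carrier, x < st.bound → x ∈ st'.carrier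
  le : ∀ X ⊆ st'.carrier, X.Infinite → st'.arr X = st.arr X ∨ lt (st'.arr X) (st.arr X)
  frozen : ∀ X ⊆ st'.carrier, X.Infinite → X ∈ st.frozen → st'.arr X = st.arr X
  frozen_subset : st.frozen ⊆ st'.frozen
  nil : st.todo = [] → (∃ x ∈ st'.carrier, st.bound ≤ x ∧ x < st'.bound) ∧ st'.frozen = st.frozen ∧
    ∀ s ⊆ Finset.range st'.bound, s ∈ st'.todo
  cons : ∀ s l, st.todo = s :: l → st'.bound = st.bound ∧ st'.todo = l ∧
    ((st'.frozen = st.frozen ∧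
      ∀ X ⊆ st'.carrier, X.Infinite → X ∈ nbhd st.bound s → lt (st'.arr X) (st.arr X)) ∨
    (st'.frozen = st.frozen ∪ nbhd st.bound s ∧ ∀ D h, ¬ Improves r lt st s D h))

variable {r lt}

theorem exists_step (hc : ∀ x y z, r x y → lt y z → r x z) (st : MinState α)
    (hst : BadArray r st.carrier st.arr) : ∃ st', Step r lt st st' := by
  classical
  rcases hl : st.todo with _ | ⟨s, l⟩
  · obtain ⟨x, hx, hxb⟩ := hst.infinite.exists_gt st.bound
    refine ⟨⟨x + 1, st.carrier, st.arr, st.frozen, (Finset.range (x + 1)).powerset.toList⟩,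
      hst, subset_rfl, fun _ h _ => h, fun _ _ _ => Or.inl rfl, fun _ _ _ _ => rfl, subset_rfl,
      fun _ => ⟨⟨x, hx, hxb.le, Nat.lt_succ_self x⟩, rfl, fun s hs => by simpa using hs⟩,
      fun s l h => by simp [hl] at h⟩
  · by_cases him : ∃ D h, Improves r lt st s D h
    · obtain ⟨D, h, him⟩ := him
      have hD : ∀ X ⊆ {x ∈ st.carrier | x < st.bound ∨ x ∈ D}, X ∈ nbhd st.bound s → X ⊆ D := by
        intro X hX hXs x hx
        by_cases hxb : x < st.bound
        · exact (him.start x (hX hx).1 hxb).2 ((hXs x hxb).1 hx)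
        · exact (hX hx).2.resolve_left hxb
      refine ⟨⟨st.bound, {x ∈ st.carrier | x < st.bound ∨ x ∈ D},
        fun X => if X ⊆ D then h X else st.arr X, st.frozen, l⟩, ⟨?_, ?_, ?_⟩, fun x hx => hx.1,
        fun x hx hb => ⟨hx, Or.inl hb⟩, ?_, ?_, subset_rfl, fun h => by simp [hl] at h, ?_⟩
      · exact him.badArray.infinite.mono fun x hx => ⟨him.subset hx, Or.inr hx⟩
      · intro X hX hXi
        by_cases hXD : X ⊆ D
        · obtain ⟨n, hn⟩ := him.badArray.locConst X hXD hXi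
          refine ⟨max n st.bound, fun Y hY hYi hag => ?_⟩
          have hYD : Y ⊆ D := by
            intro y hy
            by_cases hyb : y < st.bound
            · exact hXD ((hag y (lt_max_of_lt_right hyb)).1 hy)
            · exact (hY hy).2.resolve_left hyb
          simp only [hXD, hYD, if_true]
          exact hn Y hYD hYi fun i hi => hag i (lt_max_of_lt_left hi)
        · obtain ⟨n, hn⟩ := hst.locConst X (fun x hx => (hX hx).1) hXi
          obtain ⟨x, hx, hxD⟩ := Set.not_subset.1 hXD
          refine ⟨max n (x + 1), fun Y hY hYi hag => ?_⟩
          have hYD : ¬ Y ⊆ D := fun h =>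
            hxD (h ((hag x (lt_max_of_lt_right (Nat.lt_succ_self x))).2 hx))
          simp only [hXD, hYD, if_false]
          exact hn Y (fun x hx => (hY hx).1) hYi fun i hi => hag i (lt_max_of_lt_left hi)
      · intro X hX hXi
        have hXA : X ⊆ st.carrier := fun x hx => (hX hx).1
        by_cases hXD : X ⊆ D
        · simpa only [hXD, (shift_subset X).trans hXD, if_true] using him.badArray.bad X hXD hXi
        · by_cases hSD : shift X ⊆ D
          · simp only [hXD, hSD, if_true, if_false]
            intro hr
            refine hst.bad X hXA hXi ?_
            rcases him.le _ hSD (infinite_shift hXi) with h' | h'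
            · rwa [← h']
            · exact hc _ _ _ hr h'
          · simpa only [hXD, hSD, if_false] using hst.bad X hXA hXi
      · intro X hX hXi
        by_cases hXD : X ⊆ D
        · simpa only [hXD, if_true] using him.le X hXD hXi
        · simp only [hXD, if_false, true_or]
      · intro X hX hXi hXZ
        by_cases hXD : X ⊆ D
        · simpa only [hXD, if_true] using him.frozen X hXD hXi hXZ
        · simp only [hXD, if_false]
      · intro s' l' hl'
        rw [hl, List.cons.injEq] at hl'
        obtain ⟨rfl, rfl⟩ := hl'
        refine ⟨rfl, rfl, Or.inl ⟨rfl, fun X hX hXi hXs => ?_⟩⟩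
        simpa only [hD X hX hXs, if_true] using him.lt X (hD X hX hXs) hXi hXs
    · refine ⟨⟨st.bound, st.carrier, st.arr, st.frozen ∪ nbhd st.bound s, l⟩, hst, subset_rfl,
        fun _ h _ => h, fun _ _ _ => Or.inl rfl, fun _ _ _ _ => rfl, Set.subset_union_left,
        fun h => by simp [hl] at h, ?_⟩
      intro s' l' hl'
      rw [hl, List.cons.injEq] at hl'
      obtain ⟨rfl, rfl⟩ := hl'
      exact ⟨rfl, rfl, Or.inr ⟨rfl, fun D h hi => him ⟨D, h, hi⟩⟩⟩

end MinState

open MinState in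
/-- The minimal bad array lemma. -/
theorem BadArray.exists_minimal {α : Type*} {r lt : α → α → Prop} (hwf : WellFounded lt)
    (htr : ∀ x y z, lt x y → lt y z → lt x z) (hc : ∀ x y z, r x y → lt y z → r x z)
    {A : Set ℕ} {f : Set ℕ → α} (hf : BadArray r A f) :
    ∃ B ⊆ A, ∃ g, BadArray r B g ∧ (∀ X ⊆ B, X.Infinite → g X = f X ∨ lt (g X) (f X)) ∧
      ∀ C ⊆ B, ∀ h, BadArray r C h → ¬ ∀ X ⊆ C, X.Infinite → lt (h X) (g X) := by
  classical
  obtain ⟨S, hS0, hbad, hstep⟩ : ∃ S : ℕ → MinState α, S 0 = ⟨0, A, f, ∅, []⟩ ∧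
      (∀ n, BadArray r (S n).carrier (S n).arr) ∧ ∀ n, Step r lt (S n) (S (n + 1)) := by
    choose! nxt hnxt using fun st hst => exists_step (r := r) (lt := lt) hc st hst
    let S : ℕ → MinState α := fun n => Nat.rec ⟨0, A, f, ∅, []⟩ (fun _ st => nxt st) n
    have hbad : ∀ n, BadArray r (S n).carrier (S n).arr := by
      intro n
      induction n with
      | zero => exact hf
      | succ n ih => exact (hnxt _ ih).badArray
    exact ⟨S, rfl, hbad, fun n => hnxt _ (hbad n)⟩
  have hcar : Antitone fun n => (S n).carrier := antitone_nat_of_succ_le fun n => (hstep n).subset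
  have hZ : Monotone fun n => (S n).frozen :=
    monotone_nat_of_le_succ fun n => (hstep n).frozen_subset
  have hb1 : ∀ n, (S n).bound ≤ (S (n + 1)).bound := by
    intro n
    rcases hl : (S n).todo with _ | ⟨s, l⟩
    · obtain ⟨⟨x, _, h1, h2⟩, _⟩ := (hstep n).nil hl
      omega
    · exact ((hstep n).cons _ _ hl).1.ge
  have hb : Monotone fun n => (S n).bound := monotone_nat_of_le_succ hb1
  have hkeep : ∀ n m, n ≤ m → ∀ x ∈ (S n).carrier, x < (S n).bound → x ∈ (S m).carrier := by
    intro n m hnm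
    induction m, hnm using Nat.le_induction with
    | base => exact fun x hx _ => hx
    | succ m hnm ih =>
      exact fun x hx hxb => (hstep m).keep x (ih x hx hxb) (hxb.trans_le (hb hnm))
  have hdrop : ∀ n i, i ≤ (S n).todo.length →
      (S (n + i)).todo = (S n).todo.drop i ∧ (S (n + i)).bound = (S n).bound := by
    intro n i
    induction i with
    | zero => simp
    | succ i ih =>
      intro hi
      obtain ⟨h1, h2⟩ := ih (by omega)
      rw [List.drop_eq_getElem_cons (by omega)] at h1
      obtain ⟨h3, h4, _⟩ := (hstep (n + i)).cons _ _ h1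
      exact ⟨h4, h3.trans h2⟩
  have hnil : ∀ n, ∃ m ≥ n, (S m).todo = [] := fun n =>
    ⟨n + (S n).todo.length, by omega, by rw [(hdrop n _ le_rfl).1, List.drop_length]⟩
  let A' : Set ℕ := ⋂ n, (S n).carrier
  have hA' : ∀ n, A' ⊆ (S n).carrier := fun n => Set.iInter_subset _ n
  have hlarge : ∀ n, ∃ x ∈ A', (S n).bound ≤ x ∧ ∃ m, x < (S m).bound := by
    intro n
    obtain ⟨m, hm, hml⟩ := hnil n
    obtain ⟨⟨x, hx, h1, h2⟩, _⟩ := (hstep m).nil hml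
    refine ⟨x, Set.mem_iInter.2 fun j => ?_, (hb hm).trans h1, m + 1, h2⟩
    rcases le_total (m + 1) j with hj | hj
    · exact hkeep (m + 1) j hj x hx h2
    · exact hcar hj hx
  have hA'i : A'.Infinite := by
    have key : ∀ k, ∃ n, k ≤ (S n).bound := by
      intro k
      induction k with
      | zero => exact ⟨0, Nat.zero_le _⟩
      | succ k ih =>
        obtain ⟨n, hn⟩ := ih
        obtain ⟨x, _, h1, m, hm⟩ := hlarge n
        exact ⟨m, by omega⟩
    refine Set.infinite_of_forall_exists_gt fun k => ?_
    obtain ⟨n, hn⟩ := key (k + 1)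
    obtain ⟨x, hx, h1, _⟩ := hlarge n
    exact ⟨x, hx, by omega⟩
  have hle : ∀ X ⊆ A', X.Infinite → ∀ n m, n ≤ m →
      (S m).arr X = (S n).arr X ∨ lt ((S m).arr X) ((S n).arr X) := by
    intro X hX hXi n m hnm
    induction m, hnm using Nat.le_induction with
    | base => exact Or.inl rfl
    | succ m hnm ih =>
      rcases (hstep m).le X (hX.trans (hA' _)) hXi with h | h
      · rwa [h]
      · rcases ih with h' | h'
        · exact Or.inr (h' ▸ h)
        · exact Or.inr (htr _ _ _ h h')
  have hfz : ∀ X ⊆ A', X.Infinite → ∀ n m, n ≤ m → X ∈ (S n).frozen →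
      (S m).arr X = (S n).arr X := by
    intro X hX hXi n m hnm hXZ
    induction m, hnm using Nat.le_induction with
    | base => rfl
    | succ m hnm ih =>
      rw [(hstep m).frozen X (hX.trans (hA' _)) hXi (hZ hnm hXZ), ih]
  have hstab : ∀ X ⊆ A', X.Infinite → ∃ n s, X ∈ nbhd (S n).bound s ∧
      nbhd (S n).bound s ⊆ (S (n + 1)).frozen := by
    intro X hX hXi
    obtain ⟨a, ⟨N, rfl⟩, hN⟩ := hwf.has_min (Set.range fun n => (S n).arr X) ⟨_, 0, rfl⟩
    have hN' : ∀ n ≥ N, (S n).arr X = (S N).arr X := fun n hn =>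
      (hle X hX hXi N n hn).resolve_right (hN _ ⟨n, rfl⟩)
    obtain ⟨m, hm, hml⟩ := hnil N
    let s := (Finset.range (S (m + 1)).bound).filter (· ∈ X)
    have hs := ((hstep m).nil hml).2.2 s (Finset.filter_subset _ _)
    obtain ⟨i, hi, his⟩ := List.getElem_of_mem hs
    obtain ⟨h1, h2⟩ := hdrop (m + 1) i hi.le
    rw [List.drop_eq_getElem_cons hi, his] at h1
    have hXs : X ∈ nbhd (S (m + 1 + i)).bound s := by
      intro j hj
      rw [h2] at hj
      simp [s, hj]
    refine ⟨m + 1 + i, s, hXs, ?_⟩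
    rcases ((hstep _).cons _ _ h1).2.2 with h | h
    · have := h.2 X (hX.trans (hA' _)) hXi hXs
      rw [hN' (m + 1 + i + 1) (by omega), hN' (m + 1 + i) (by omega)] at this
      exact absurd this (hN _ ⟨N, rfl⟩)
    · rw [h.1]; exact Set.subset_union_right
  choose! lim s hlim hlimZ using hstab
  let g : Set ℕ → α := fun X => (S (lim X + 1)).arr X
  have hg : ∀ X ⊆ A', X.Infinite → ∀ n, X ∈ (S n).frozen → g X = (S n).arr X := by
    intro X hX hXi n hn
    rcases le_total n (lim X + 1) with h | h
    · exact hfz X hX hXi _ _ h hn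
    · exact (hfz X hX hXi _ _ h (hlimZ X hX hXi (hlim X hX hXi))).symm
  have hgle : ∀ X ⊆ A', X.Infinite → ∀ n, g X = (S n).arr X ∨ lt (g X) ((S n).arr X) := by
    intro X hX hXi n
    rw [hg X hX hXi (max n (lim X + 1))
      (hZ (le_max_right _ _) (hlimZ X hX hXi (hlim X hX hXi)))]
    exact hle X hX hXi _ _ (le_max_left _ _)
  refine ⟨A', (hA' 0).trans (by rw [hS0]), g, ⟨hA'i, ?_, ?_⟩,
    fun X hX hXi => by simpa only [hS0] using hgle X hX hXi 0, ?_⟩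
  · intro X hX hXi
    obtain ⟨n, hn⟩ := (hbad (lim X + 1)).locConst X (hX.trans (hA' _)) hXi
    refine ⟨max n (S (lim X)).bound, fun Y hY hYi hag => ?_⟩
    have hYZ : Y ∈ (S (lim X + 1)).frozen := hlimZ X hX hXi fun i hi =>
      (hag i (lt_max_of_lt_right hi)).trans (hlim X hX hXi i hi)
    rw [hg Y hY hYi _ hYZ]
    exact hn Y (hY.trans (hA' _)) hYi fun i hi => hag i (lt_max_of_lt_left hi)
  · intro X hX hXi
    let n := max (lim X + 1) (lim (shift X) + 1)
    have hS := (shift_subset X).trans hX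
    have hSi := infinite_shift hXi
    rw [hg X hX hXi n (hZ (le_max_left _ _) (hlimZ X hX hXi (hlim X hX hXi))),
      hg _ hS hSi n (hZ (le_max_right _ _) (hlimZ _ hS hSi (hlim _ hS hSi)))]
    exact (hbad n).bad X (hX.trans (hA' _)) hXi
  · intro C hC h hh hlt
    have hex : ∃ n, ∃ X ⊆ C, X.Infinite ∧ X ∈ (S n).frozen :=
      ⟨_, C, subset_rfl, hh.infinite, hlimZ C hC hh.infinite (hlim C hC hh.infinite)⟩
    obtain ⟨X, hXC, hXi, hXZ⟩ := Nat.find_spec hex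
    have hmin := fun m => Nat.find_min hex (m := m)
    generalize Nat.find hex = n at hXZ hmin
    rcases n with _ | n
    · simp [hS0] at hXZ
    have hXn : X ∉ (S n).frozen := fun h => hmin n (Nat.lt_succ_self n) ⟨X, hXC, hXi, h⟩
    rcases hl : (S n).todo with _ | ⟨s, l⟩
    · exact hXn (((hstep n).nil hl).2.1 ▸ hXZ)
    obtain ⟨_, _, h1 | h1⟩ := (hstep n).cons _ _ hl
    · exact hXn (h1.1 ▸ hXZ)
    rw [h1.1] at hXZ
    have hXs := hXZ.resolve_left hXn
    have hDC : {x ∈ C | x < (S n).bound → x ∈ s} ⊆ C := fun x hx => hx.1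
    refine h1.2 {x ∈ C | x < (S n).bound → x ∈ s} h ⟨hDC.trans (hC.trans (hA' _)), ?_,
      hh.mono hDC (hXi.mono fun x hx => ⟨hXC hx, fun hb => (hXs x hb).1 hx⟩), ?_, ?_, ?_⟩
    · exact fun x _ hxb => ⟨fun hx => hx.2 hxb, fun hx => ⟨hXC ((hXs x hxb).2 hx), fun _ => hx⟩⟩
    · intro Y hY hYi
      have hYC := hY.trans hDC
      rcases hgle Y (hYC.trans hC) hYi n with h' | h'
      · exact Or.inr (h' ▸ hlt Y hYC hYi)
      · exact Or.inr (htr _ _ _ (hlt Y hYC hYi) h')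
    · intro Y hY hYi hYZ
      exact absurd ⟨Y, hY.trans hDC, hYi, hYZ⟩ (hmin n (Nat.lt_succ_self n))
    · intro Y hY hYi _
      have hYC := hY.trans hDC
      rcases hgle Y (hYC.trans hC) hYi n with h' | h'
      · exact h' ▸ hlt Y hYC hYi
      · exact htr _ _ _ (hlt Y hYC hYi) h'

end BQO

namespace BQO

variable {Q : Type*}

/-- Domination of finite families along an injection of the index sets. -/
def FamLE (r : Q → Q → Prop) (l l' : Σ n, Fin n → Q) : Prop :=
  ∃ φ : Fin l.1 → Fin l'.1, φ.Injective ∧ ∀ i, r (l.2 i) (l'.2 (φ i))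

theorem BadArray.exists_fam {r : Q → Q → Prop} {A : Set ℕ} {f : Set ℕ → Σ n, Fin n → Q}
    (hf : BadArray (FamLE r) A f) :
    ∃ B ⊆ A, ∃ g, BadArray r B g ∧ ∀ X ⊆ B, X.Infinite → ∃ i, (f X).2 i = g X := by
  classical
  let lt : (Σ n, Fin n → Q) → (Σ n, Fin n → Q) → Prop := fun l l' =>
    l.1 < l'.1 ∧ ∃ φ : Fin l.1 → Fin l'.1, φ.Injective ∧ ∀ i, l.2 i = l'.2 (φ i)
  have hwf : WellFounded lt := Subrelation.wf (fun h => h.1) (measure Sigma.fst).wf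
  obtain ⟨B, hBA, g, hg, hgf, hmin⟩ := hf.exists_minimal (lt := lt) hwf
    (by
      rintro x y z ⟨h, φ, hφ, hxy⟩ ⟨h', ψ, hψ, hyz⟩
      exact ⟨h.trans h', ψ ∘ φ, hψ.comp hφ, fun i => (hxy i).trans (hyz _)⟩)
    (by
      rintro x y z ⟨φ, hφ, hxy⟩ ⟨_, ψ, hψ, hyz⟩
      exact ⟨ψ ∘ φ, hψ.comp hφ, fun i => by
        have := hxy i
        rwa [hyz] at this⟩)
  have hpos : ∀ X ⊆ B, X.Infinite → 0 < (g X).1 := by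
    intro X hX hXi
    by_contra h0
    have h0 : (g X).1 = 0 := by omega
    have : IsEmpty (Fin (g X).1) := by rw [h0]; infer_instance
    exact hg.bad X hX hXi ⟨isEmptyElim, Function.injective_of_subsingleton _, isEmptyElim⟩
  have q0 : Q := (g B).2 ⟨0, hpos B subset_rfl hg.infinite⟩
  let head : (Σ n, Fin n → Q) → Q := fun l => if h : 0 < l.1 then l.2 ⟨0, h⟩ else q0
  let tail : (Σ n, Fin n → Q) → Σ n, Fin n → Q := fun l =>
    ⟨l.1 - 1, fun i => l.2 ⟨i + 1, by omega⟩⟩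
  have hhead : LocConst B fun X => head (g X) := hg.locConst.comp head
  obtain ⟨C, hCB, hCi, hC | hC⟩ := LocConst.ramsey (A := B)
    (P := fun X => r (head (g X)) (head (g (shift X)))) hg.infinite
    ((hhead.prodMk hhead.comp_shift).comp fun p => r p.1 p.2)
  · refine absurd ?_ (hmin C hCB (fun X => tail (g X))
      ⟨hCi, (hg.locConst.comp tail).mono hCB, ?_⟩)
    · intro X hX hXi
      have := hpos X (hX.trans hCB) hXi
      refine ⟨by dsimp only [tail]; omega, fun i => ⟨i + 1, ?_⟩, ?_, fun i => rfl⟩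
      · have := i.2
        dsimp only [tail] at this
        omega
      · intro i j hij
        ext
        simpa using hij
    · rintro X hX hXi ⟨φ, hφ, h⟩
      have hX0 := hpos X (hX.trans hCB) hXi
      have hS0 := hpos _ ((shift_subset X).trans (hX.trans hCB)) (infinite_shift hXi)
      have hr := hC X hX hXi
      simp only [head, hX0, hS0, dif_pos] at hr
      refine hg.bad X (hX.trans hCB) hXi ⟨fun i => if hi : i.1 = 0 then ⟨0, hS0⟩ else
        ⟨φ ⟨i.1 - 1, by dsimp only [tail]; omega⟩ + 1, ?_⟩, ?_, ?_⟩
      · have := (φ ⟨i.1 - 1, by dsimp only [tail]; omega⟩).2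
        dsimp only [tail] at this ⊢
        omega
      · intro i j hij
        by_cases hi : i.1 = 0 <;> by_cases hj : j.1 = 0
        · exact Fin.ext (hi.trans hj.symm)
        · simp [hi, hj] at hij
        · simp [hi, hj] at hij
        · simp only [hi, hj, dif_neg, not_false_eq_true, Fin.mk.injEq, add_left_inj] at hij
          have := hφ (Fin.ext hij)
          simp only [Fin.mk.injEq] at this
          exact Fin.ext (by omega)
      · intro i
        by_cases hi : i.1 = 0
        · simp only [hi, dif_pos]
          have : i = ⟨0, hX0⟩ := Fin.ext hi
          rwa [this]
        · simp only [hi, dif_neg, not_false_eq_true]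
          have := h ⟨i.1 - 1, by dsimp only [tail]; omega⟩
          dsimp only [tail] at this
          convert this using 2
          exact Fin.ext (by dsimp only; omega)
  · refine ⟨C, hCB.trans hBA, fun X => head (g X), ⟨hCi, hhead.mono hCB, hC⟩, fun X hX hXi => ?_⟩
    have hX0 := hpos X (hX.trans hCB) hXi
    simp only [head, hX0, dif_pos]
    rcases hgf X (hX.trans hCB) hXi with h | ⟨_, φ, _, h⟩
    · have key : ∀ l (h0 : 0 < l.1), l = f X → ∃ i, (f X).2 i = l.2 ⟨0, h0⟩ := by
        rintro l h0 rfl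
        exact ⟨_, rfl⟩
      exact key _ hX0 h
    · exact ⟨_, (h _).symm⟩

/-- A finite family of elements together with a countable family of elements. -/
structure NodeD (Q : Type*) where
  n : ℕ
  fin : Fin n → Q
  idx : Set ℕ
  inf : idx → Q

namespace NodeD

/-- `q` occurs in `N`. -/
def Elem (N : NodeD Q) (q : Q) : Prop := (∃ i, N.fin i = q) ∨ ∃ i, N.inf i = q

/-- Injective domination of the finite parts and plain domination of the countable parts. -/
def LE (r : Q → Q → Prop) (N N' : NodeD Q) : Prop :=
  FamLE r ⟨N.n, N.fin⟩ ⟨N'.n, N'.fin⟩ ∧ ∀ i, ∃ j, r (N.inf i) (N'.inf j)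

end NodeD

theorem BadArray.exists_elem {r : Q → Q → Prop} {A : Set ℕ} {f : Set ℕ → NodeD Q}
    (hf : BadArray (NodeD.LE r) A f) :
    ∃ B ⊆ A, ∃ g, BadArray r B g ∧ ∀ X ⊆ B, X.Infinite → (f X).Elem (g X) := by
  let F : NodeD Q → Σ n, Fin n → Q := fun N => ⟨N.n, N.fin⟩
  obtain ⟨B, hBA, hBi, hB | hB⟩ := LocConst.ramsey (A := A)
    (P := fun X => FamLE r (F (f X)) (F (f (shift X)))) hf.infinite
    ((hf.locConst.prodMk hf.locConst.comp_shift).comp fun p => FamLE r (F p.1) (F p.2))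
  · have hex : ∀ X ⊆ B, X.Infinite → ∃ i, ∀ j, ¬ r ((f X).inf i) ((f (shift X)).inf j) := by
      intro X hX hXi
      by_contra! hcon
      exact hf.bad X (hX.trans hBA) hXi ⟨hB X hX hXi, hcon⟩
    have hQ : Nonempty Q := by
      obtain ⟨i, _⟩ := hex B subset_rfl hBi
      exact ⟨(f B).inf i⟩
    have hchoice : ∀ p : NodeD Q × NodeD Q, ∃ q, (∃ i, ∀ j, ¬ r (p.1.inf i) (p.2.inf j)) →
        (∃ i, p.1.inf i = q) ∧ ∀ j, ¬ r q (p.2.inf j) := by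
      intro p
      by_cases h : ∃ i, ∀ j, ¬ r (p.1.inf i) (p.2.inf j)
      · obtain ⟨i, hi⟩ := h
        exact ⟨p.1.inf i, fun _ => ⟨⟨i, rfl⟩, hi⟩⟩
      · exact ⟨hQ.some, fun h' => absurd h' h⟩
    choose e he using hchoice
    refine ⟨B, hBA, fun X => e (f X, f (shift X)), ⟨hBi, ?_, ?_⟩, ?_⟩
    · exact ((hf.locConst.prodMk hf.locConst.comp_shift).comp e).mono hBA
    · intro X hX hXi
      obtain ⟨⟨j, hj⟩, _⟩ := he (f (shift X), f (shift (shift X)))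
        (hex _ ((shift_subset X).trans hX) (infinite_shift hXi))
      dsimp only at hj ⊢
      rw [← hj]
      exact (he (f X, f (shift X)) (hex X hX hXi)).2 j
    · intro X hX hXi
      exact Or.inr (he (f X, f (shift X)) (hex X hX hXi)).1
  · have hbad : BadArray (FamLE r) B fun X => F (f X) :=
      ⟨hBi, (hf.locConst.comp F).mono hBA, hB⟩
    obtain ⟨C, hCB, g, hg, h⟩ := hbad.exists_fam
    exact ⟨C, hCB.trans hBA, g, hg, fun X hX hXi => Or.inl (h X hX hXi)⟩

/-- A relation without bad arrays has no bad sequences. -/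
theorem exists_le_of_no_badArray {r : Q → Q → Prop} (h : ∀ A f, ¬ BadArray r A f)
    (q : ℕ → Q) : ∃ i j, i < j ∧ r (q i) (q j) := by
  by_contra! hcon
  refine h Set.univ (fun X => q (sInf X)) ⟨Set.infinite_univ, ?_, ?_⟩
  · intro X _ hXi
    refine ⟨sInf X + 1, fun Y _ hYi hag => ?_⟩
    have h1 : sInf X ∈ Y := (hag _ (Nat.lt_succ_self _)).2 (Nat.sInf_mem hXi.nonempty)
    have h2 : sInf Y ≤ sInf X := Nat.sInf_le h1
    have h3 : sInf Y ∈ X := (hag _ (Nat.lt_succ_of_le h2)).1 (Nat.sInf_mem hYi.nonempty)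
    exact congrArg q (le_antisymm h2 (Nat.sInf_le h3))
  · intro X _ hXi
    refine hcon _ _ (lt_of_le_of_ne (Nat.sInf_le (shift_subset X ?_)) ?_)
    · exact Nat.sInf_mem (infinite_shift hXi).nonempty
    · intro heq
      have := Nat.sInf_mem (infinite_shift hXi).nonempty
      rw [← heq] at this
      exact this.2 rfl

end BQO

/-! ### Trees of finite sequences and their codes -/

namespace TreeCode

open BQO

/-- The subtree of `T` above `y`. -/
def sub (T : Set (List ℕ)) (y : List ℕ) : Set (List ℕ) := {z | y ++ z ∈ T}

@[simp] theorem mem_sub {T : Set (List ℕ)} {y z : List ℕ} : z ∈ sub T y ↔ y ++ z ∈ T := Iff.rfl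

@[simp] theorem sub_nil (T : Set (List ℕ)) : sub T [] = T := rfl

theorem sub_sub (T : Set (List ℕ)) (y z : List ℕ) : sub (sub T y) z = sub T (y ++ z) := by
  ext w; simp [List.append_assoc]

/-- Hereditary codes for topological types of rooted trees. -/
inductive Code : Type
  | node (n : ℕ) (fin : Fin n → Code) (idx : Set ℕ) (inf : idx → Code)
  | tail (d : ℕ → ℕ) (n : ℕ → ℕ) (fin : ∀ i, Fin (n i) → Code) (idx : ℕ → Set ℕ)
      (inf : ∀ i, idx i → Code)

/-- The tree `S`, with the kids in `E` removed, has room above its root for everything listed,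
where `U q S'` means that `S'` has room for `q`. -/
def NodeUp {Q : Type*} (U : Q → Set (List ℕ) → Prop) (N : NodeD Q) (S : Set (List ℕ))
    (E : Set ℕ) : Prop :=
  (∃ k : Fin N.n → ℕ, k.Injective ∧ ∀ i, k i ∉ E ∧ [k i] ∈ S ∧ U (N.fin i) (sub S [k i])) ∧
    ∀ i, {k | [k] ∈ S ∧ U (N.inf i) (sub S [k])}.Infinite

/-- The tree `T` has room for the code. -/
def Code.Up : Code → Set (List ℕ) → Prop
  | .node n fin _ inf, T => ∃ y ∈ T,
      (∃ k : Fin n → ℕ, k.Injective ∧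
        ∀ i, k i ∉ (∅ : Set ℕ) ∧ [k i] ∈ sub T y ∧ (fin i).Up (sub (sub T y) [k i])) ∧
      ∀ i, {k | [k] ∈ sub T y ∧ (inf i).Up (sub (sub T y) [k])}.Infinite
  | .tail d n fin _ inf, T => ∃ V ⊆ T, V.Nonempty ∧ ∀ x ∈ V, ∀ i, ∃ y, x ++ y ∈ T ∧
      ∃ e : Fin (d i) → ℕ, e.Injective ∧ (∀ j, ∃ z ∈ V, x ++ y ++ [e j] <+: z) ∧
      (∃ k : Fin (n i) → ℕ, k.Injective ∧ ∀ j, k j ∉ Set.range e ∧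
        [k j] ∈ sub T (x ++ y) ∧ (fin i j).Up (sub (sub T (x ++ y)) [k j])) ∧
      ∀ j, {k | [k] ∈ sub T (x ++ y) ∧ (inf i j).Up (sub (sub T (x ++ y)) [k])}.Infinite

namespace Code

/-- The code of a node. -/
def ofNode (N : NodeD Code) : Code := .node N.n N.fin N.idx N.inf

/-- The code of a sequence of nodes with multiplicities. -/
def ofTail (P : ℕ → ℕ × NodeD Code) : Code :=
  .tail (fun i => (P i).1) (fun i => (P i).2.n) (fun i => (P i).2.fin) (fun i => (P i).2.idx)
    (fun i => (P i).2.inf)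

theorem up_ofNode {N : NodeD Code} {T : Set (List ℕ)} :
    (ofNode N).Up T ↔ ∃ y ∈ T, NodeUp Up N (sub T y) ∅ := by
  rw [ofNode, Up]; rfl

theorem up_ofTail {P : ℕ → ℕ × NodeD Code} {T : Set (List ℕ)} :
    (ofTail P).Up T ↔ ∃ V ⊆ T, V.Nonempty ∧ ∀ x ∈ V, ∀ i, ∃ y, x ++ y ∈ T ∧
      ∃ e : Fin (P i).1 → ℕ, e.Injective ∧ (∀ j, ∃ z ∈ V, x ++ y ++ [e j] <+: z) ∧
      NodeUp Up (P i).2 (sub T (x ++ y)) (Set.range e) := by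
  rw [ofTail, Up]; rfl

theorem ofNode_or_ofTail (c : Code) : (∃ N, ofNode N = c) ∨ ∃ P, ofTail P = c := by
  rcases c with ⟨n, fin, idx, inf⟩ | ⟨d, n, fin, idx, inf⟩
  · exact Or.inl ⟨⟨n, fin, idx, inf⟩, rfl⟩
  · exact Or.inr ⟨fun i => (d i, ⟨n i, fin i, idx i, inf i⟩), rfl⟩

/-- Induction on codes through nodes and tails. -/
theorem induction_on {p : Code → Prop} (c : Code)
    (hnode : ∀ N : NodeD Code, (∀ c, N.Elem c → p c) → p (ofNode N))
    (htail : ∀ P : ℕ → ℕ × NodeD Code, (∀ i c, (P i).2.Elem c → p c) → p (ofTail P)) : p c := by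
  induction c with
  | node n fin idx inf h1 h2 =>
    refine hnode ⟨n, fin, idx, inf⟩ ?_
    rintro _ (⟨i, rfl⟩ | ⟨i, rfl⟩)
    · exact h1 i
    · exact h2 i
  | tail d n fin idx inf h1 h2 =>
    refine htail (fun i => (d i, ⟨n i, fin i, idx i, inf i⟩)) ?_
    rintro i _ (⟨j, rfl⟩ | ⟨j, rfl⟩)
    · exact h1 i j
    · exact h2 i j

/-- The node of a code. -/
def toNode : Code → NodeD Code
  | .node n fin idx inf => ⟨n, fin, idx, inf⟩
  | .tail _ n fin idx inf => ⟨n 0, fin 0, idx 0, inf 0⟩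

/-- The sequence of nodes of a code. -/
def toTail : Code → ℕ → ℕ × NodeD Code
  | .node n fin idx inf => fun _ => (0, ⟨n, fin, idx, inf⟩)
  | .tail d n fin idx inf => fun i => (d i, ⟨n i, fin i, idx i, inf i⟩)

theorem toNode_ofNode (N : NodeD Code) : toNode (ofNode N) = N := rfl

theorem toTail_ofTail (P : ℕ → ℕ × NodeD Code) : toTail (ofTail P) = P := rfl

theorem ofNode_ne_ofTail (N : NodeD Code) (P : ℕ → ℕ × NodeD Code) : ofNode N ≠ ofTail P := by
  simp [ofNode, ofTail]

/-- `c` occurs immediately inside `c'`. -/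
def Child (c c' : Code) : Prop :=
  (∃ N, ofNode N = c' ∧ N.Elem c) ∨ ∃ P i, ofTail P = c' ∧ (P i).2.Elem c

theorem wellFounded_child : WellFounded Child := by
  refine ⟨fun c => ?_⟩
  induction c using induction_on with
  | hnode N ih =>
    refine ⟨_, fun c hc => ?_⟩
    rcases hc with ⟨N', h, hc⟩ | ⟨P, i, h, hc⟩
    · have : N' = N := congrArg toNode h
      exact ih c (this ▸ hc)
    · exact absurd h.symm (ofNode_ne_ofTail _ _)
  | htail P ih =>
    refine ⟨_, fun c hc => ?_⟩
    rcases hc with ⟨N', h, hc⟩ | ⟨P', i, h, hc⟩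
    · exact absurd h (ofNode_ne_ofTail _ _)
    · have : P' = P := congrArg toTail h
      exact ih i c (this ▸ hc)

/-- Every tree with room for `c'` has room for `c`. -/
def LE (c c' : Code) : Prop := ∀ T, c'.Up T → c.Up T

theorem LE.trans {a b c : Code} (h : a.LE b) (h' : b.LE c) : a.LE c := fun T hT => h T (h' T hT)

theorem _root_.TreeCode.NodeUp.mono {N N' : NodeD Code} (h : N.LE LE N') {S : Set (List ℕ)}
    {E : Set ℕ} (hN : NodeUp Up N' S E) : NodeUp Up N S E := by
  obtain ⟨⟨k, hk, hkE⟩, hinf⟩ := hN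
  obtain ⟨⟨φ, hφ, hle⟩, h2⟩ := h
  refine ⟨⟨k ∘ φ, hk.comp hφ, fun i => ⟨(hkE _).1, (hkE _).2.1, hle i _ (hkE _).2.2⟩⟩, fun i => ?_⟩
  obtain ⟨j, hj⟩ := h2 i
  exact (hinf j).mono fun x hx => ⟨hx.1, hj _ hx.2⟩

theorem ofNode_le {N N' : NodeD Code} (h : N.LE LE N') : (ofNode N).LE (ofNode N') := by
  intro T hT
  rw [up_ofNode] at hT ⊢
  obtain ⟨y, hy, hN⟩ := hT
  exact ⟨y, hy, hN.mono h⟩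

/-- The order on nodes with multiplicities. -/
def PairLE (p q : ℕ × NodeD Code) : Prop := p.1 ≤ q.1 ∧ p.2.LE LE q.2

theorem ofTail_le {P P' : ℕ → ℕ × NodeD Code} (h : ∀ i, ∃ j, PairLE (P i) (P' j)) :
    (ofTail P).LE (ofTail P') := by
  intro T hT
  rw [up_ofTail] at hT ⊢
  obtain ⟨V, hVT, hV, hx⟩ := hT
  refine ⟨V, hVT, hV, fun x hxV i => ?_⟩
  obtain ⟨j, hd, hN⟩ := h i
  obtain ⟨y, hy, e, he, hez, hNU⟩ := hx x hxV j
  refine ⟨y, hy, e ∘ Fin.castLE hd, he.comp (Fin.castLE_injective hd), fun _ => hez _, ?_⟩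
  obtain ⟨⟨k, hk, hkE⟩, hinf⟩ := hNU.mono hN
  refine ⟨⟨k, hk, fun i => ⟨fun hi => (hkE i).1 ?_, (hkE i).2⟩⟩, hinf⟩
  obtain ⟨a, ha⟩ := hi
  exact ⟨_, ha⟩

theorem up_of_sub {c : Code} {T : Set (List ℕ)} {y : List ℕ} (h : c.Up (sub T y)) : c.Up T := by
  rcases c.ofNode_or_ofTail with ⟨N, rfl⟩ | ⟨P, rfl⟩
  · rw [up_ofNode] at h ⊢
    obtain ⟨z, hz, hN⟩ := h
    exact ⟨y ++ z, hz, by rwa [← sub_sub]⟩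
  · rw [up_ofTail] at h ⊢
    obtain ⟨V, hVT, ⟨v, hv⟩, hx⟩ := h
    refine ⟨(y ++ ·) '' V, ?_, ⟨_, v, hv, rfl⟩, ?_⟩
    · rintro _ ⟨x, hx, rfl⟩
      exact hVT hx
    · rintro _ ⟨x, hxV, rfl⟩ i
      obtain ⟨z, hz, e, he, hez, hNU⟩ := hx x hxV i
      refine ⟨z, by simpa using hz, e, he, fun j => ?_, ?_⟩
      · obtain ⟨w, hw, hew⟩ := hez j
        refine ⟨_, ⟨w, hw, rfl⟩, ?_⟩
        simpa [List.append_assoc] using hew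
      · rwa [sub_sub, ← List.append_assoc] at hNU

theorem _root_.TreeCode.NodeUp.up_elem {N : NodeD Code} {S : Set (List ℕ)} {E : Set ℕ}
    (hN : NodeUp Up N S E) {c : Code} (hc : N.Elem c) : c.Up S := by
  rcases hc with ⟨i, rfl⟩ | ⟨i, rfl⟩
  · obtain ⟨k, _, hk⟩ := hN.1
    exact up_of_sub (hk i).2.2
  · obtain ⟨k, hk⟩ := (hN.2 i).nonempty
    exact up_of_sub hk.2

theorem Child.le {c c' : Code} (h : Child c c') : c.LE c' := by
  intro T hT
  rcases h with ⟨N, rfl, hc⟩ | ⟨P, i, rfl, hc⟩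
  · rw [up_ofNode] at hT
    obtain ⟨y, _, hN⟩ := hT
    exact up_of_sub (hN.up_elem hc)
  · rw [up_ofTail] at hT
    obtain ⟨V, _, ⟨x, hx⟩, h⟩ := hT
    obtain ⟨y, _, e, _, _, hN⟩ := h x hx i
    exact up_of_sub (hN.up_elem hc)

theorem le_of_transGen {c c' : Code} (h : Relation.TransGen Child c c') : c.LE c' := by
  induction h with
  | single h => exact h.le
  | tail _ h ih => exact ih.trans h.le

theorem _root_.BQO.BadArray.exists_of_pair {A : Set ℕ} {f : Set ℕ → ℕ × NodeD Code}
    (hf : BadArray PairLE A f) :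
    ∃ B ⊆ A, BadArray (NodeD.LE LE) B fun X => (f X).2 := by
  have h1 : LocConst A fun X => (f X).1 := hf.locConst.comp Prod.fst
  have h2 : LocConst A fun X => (f X).2 := hf.locConst.comp Prod.snd
  obtain ⟨B, hBA, hBi, hB | hB⟩ := LocConst.ramsey (A := A)
    (P := fun X => (f X).1 ≤ (f (shift X)).1) hf.infinite
    ((h1.prodMk h1.comp_shift).comp fun p => p.1 ≤ p.2)
  · exact ⟨B, hBA, hBi, h2.mono hBA, fun X hX hXi h =>
      hf.bad X (hX.trans hBA) hXi ⟨hB X hX hXi, h⟩⟩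
  · exfalso
    have key : ∀ n, ∀ X ⊆ B, X.Infinite → (f X).1 = n → False := by
      intro n
      induction n using Nat.strong_induction_on with
      | _ n ih =>
        intro X hX hXi hn
        refine ih _ ?_ (shift X) ((shift_subset X).trans hX) (infinite_shift hXi) rfl
        have := hB X hX hXi
        omega
    exact key _ B subset_rfl hBi rfl

theorem no_badArray (A : Set ℕ) (f : Set ℕ → Code) : ¬ BadArray LE A f := by
  intro hf
  obtain ⟨B, -, g, hg, -, hmin⟩ := hf.exists_minimal (lt := Relation.TransGen Child)
    wellFounded_child.transGen (fun _ _ _ => Relation.TransGen.trans)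
    (fun _ _ _ h h' => h.trans (le_of_transGen h'))
  obtain ⟨C, hCB, hCi, hC⟩ := LocConst.ramsey (A := B)
    (P := fun X => ∃ N, ofNode N = g X) hg.infinite (hg.locConst.comp fun c => ∃ N, ofNode N = c)
  have key : ∀ D ⊆ C, ∀ F : Set ℕ → NodeD Code, BadArray (NodeD.LE LE) D F →
      (∀ X ⊆ C, X.Infinite → ∀ c, (F X).Elem c → Child c (g X)) → False := by
    intro D hDC F hF hch
    obtain ⟨D', hD', h, hh, hel⟩ := hF.exists_elem
    exact hmin D' (hD'.trans (hDC.trans hCB)) h hh fun X hX hXi =>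
      Relation.TransGen.single (hch X (hX.trans (hD'.trans hDC)) hXi _ (hel X hX hXi))
  rcases hC with hC | hC
  · have hN : ∀ X ⊆ C, X.Infinite → ofNode (toNode (g X)) = g X := by
      intro X hX hXi
      obtain ⟨N, hN⟩ := hC X hX hXi
      rw [← hN, toNode_ofNode]
    refine key C subset_rfl (fun X => toNode (g X))
      ⟨hCi, (hg.locConst.comp toNode).mono hCB, ?_⟩ fun X hX hXi c hc => Or.inl ⟨_, hN X hX hXi, hc⟩
    intro X hX hXi h
    refine hg.bad X (hX.trans hCB) hXi ?_
    rw [← hN X hX hXi, ← hN _ ((shift_subset X).trans hX) (infinite_shift hXi)]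
    exact ofNode_le h
  · have hT : ∀ X ⊆ C, X.Infinite → ofTail (toTail (g X)) = g X := by
      intro X hX hXi
      obtain ⟨P, hP⟩ := (g X).ofNode_or_ofTail.resolve_left (hC X hX hXi)
      rw [← hP, toTail_ofTail]
    have hchoice : ∀ p : Code × Code, ∃ i, (∃ i, ∀ j, ¬ PairLE (toTail p.1 i) (toTail p.2 j)) →
        ∀ j, ¬ PairLE (toTail p.1 i) (toTail p.2 j) := by
      intro p
      by_cases h : ∃ i, ∀ j, ¬ PairLE (toTail p.1 i) (toTail p.2 j)
      · exact ⟨h.choose, fun _ => h.choose_spec⟩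
      · exact ⟨0, fun h' => absurd h' h⟩
    choose e he using hchoice
    have hbad : BadArray PairLE C fun X => toTail (g X) (e (g X, g (shift X))) := by
      refine ⟨hCi, ((hg.locConst.prodMk hg.locConst.comp_shift).comp
        fun p => toTail p.1 (e p)).mono hCB, fun X hX hXi => ?_⟩
      refine he (g X, g (shift X)) ?_ _
      by_contra! hcon
      refine hg.bad X (hX.trans hCB) hXi ?_
      rw [← hT X hX hXi, ← hT _ ((shift_subset X).trans hX) (infinite_shift hXi)]
      exact ofTail_le hcon
    obtain ⟨D, hDC, hD⟩ := hbad.exists_of_pair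
    exact key D hDC _ hD fun X hX hXi c hc => Or.inr ⟨_, _, hT X hX hXi, hc⟩

theorem exists_le_of_seq (c : ℕ → Code) : ∃ i j, i < j ∧ (c i).LE (c j) :=
  exists_le_of_no_badArray no_badArray c

theorem exists_pairLE_of_seq (p : ℕ → ℕ × NodeD Code) : ∃ i j, i < j ∧ PairLE (p i) (p j) := by
  refine exists_le_of_no_badArray (fun A f hf => ?_) p
  obtain ⟨B, _, hB⟩ := hf.exists_of_pair
  obtain ⟨C, _, g, hg, _⟩ := hB.exists_elem
  exact no_badArray C g hg

end Code

end TreeCode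

namespace TreeCode

open BQO

/-- One step of an embedding of trees: the root of `A` goes to `y ∈ B` and distinct kids of the
root go above distinct kids of `y`, in a way controlled by `R`. -/
def EmbStep (R : Set (List ℕ) → Set (List ℕ) → Prop) (A B : Set (List ℕ)) : Prop :=
  ∃ y ∈ B, ∃ m : ℕ → ℕ, Set.InjOn m {k | [k] ∈ A} ∧
    ∀ k, [k] ∈ A → y ++ [m k] ∈ B ∧ R (sub A [k]) (sub B (y ++ [m k]))

/-- Topological embeddability of rooted trees. -/
def Emb (A B : Set (List ℕ)) : Prop :=
  ∃ R : Set (List ℕ) → Set (List ℕ) → Prop, R A B ∧ ∀ A B, R A B → EmbStep R A B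

theorem EmbStep.mono {R R' : Set (List ℕ) → Set (List ℕ) → Prop} (h : ∀ A B, R A B → R' A B)
    {A B : Set (List ℕ)} (hAB : EmbStep R A B) : EmbStep R' A B := by
  obtain ⟨y, hy, m, hm, hk⟩ := hAB
  exact ⟨y, hy, m, hm, fun k hkA => ⟨(hk k hkA).1, h _ _ (hk k hkA).2⟩⟩

theorem Emb.step {A B : Set (List ℕ)} (h : Emb A B) : EmbStep Emb A B := by
  obtain ⟨R, hR, hs⟩ := h
  exact (hs A B hR).mono fun A' B' h' => ⟨R, h', hs⟩

theorem Emb.of_sim {R : Set (List ℕ) → Set (List ℕ) → Prop}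
    (h : ∀ A B, R A B → EmbStep (fun A' B' => R A' B' ∨ Emb A' B') A B) {A B : Set (List ℕ)}
    (hAB : R A B) : Emb A B :=
  ⟨fun A' B' => R A' B' ∨ Emb A' B', Or.inl hAB, fun A' B' h' =>
    h'.elim (h A' B') fun h' => h'.step.mono fun _ _ => Or.inr⟩

theorem EmbStep.emb {A B : Set (List ℕ)} (h : EmbStep Emb A B) : Emb A B :=
  Emb.of_sim (R := fun A' B' => A' = A ∧ B' = B)
    (by rintro _ _ ⟨rfl, rfl⟩; exact h.mono fun _ _ => Or.inr) ⟨rfl, rfl⟩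

/-- Nonempty prefix-closed sets of finite sequences. -/
structure IsTr (T : Set (List ℕ)) : Prop where
  nil_mem : [] ∈ T
  prefix_mem : ∀ x y, x ++ y ∈ T → x ∈ T

theorem IsTr.sub {T : Set (List ℕ)} (hT : IsTr T) {x : List ℕ} (hx : x ∈ T) : IsTr (sub T x) :=
  ⟨by simpa using hx, fun y z h => hT.prefix_mem _ z (by simpa [List.append_assoc] using h)⟩

/-- The tree `S`, with the kids in `E` removed, has only what is listed above its root. -/
def NodeDown {Q : Type*} (D : Q → Set (List ℕ) → Prop) (N : NodeD Q) (S : Set (List ℕ))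
    (E : Set ℕ) : Prop :=
  ∃ a : {k // [k] ∈ S ∧ k ∉ E} → Fin N.n ⊕ N.idx,
    (∀ k k' i, a k = .inl i → a k' = .inl i → k = k') ∧
    (∀ k i, a k = .inl i → D (N.fin i) (sub S [k.1])) ∧
    ∀ k i, a k = .inr i → D (N.inf i) (sub S [k.1])

namespace Code

instance : Nonempty Code := ⟨.node 0 Fin.elim0 ∅ fun x => x.2.elim⟩

/-- The tree `T` is bounded by the code. -/
def Down : Code → Set (List ℕ) → Prop
  | .node n fin idx inf, T => ∃ a : {k // [k] ∈ T ∧ k ∉ (∅ : Set ℕ)} → Fin n ⊕ idx,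
      (∀ k k' i, a k = .inl i → a k' = .inl i → k = k') ∧
      (∀ k i, a k = .inl i → (fin i).Down (sub T [k.1])) ∧
      ∀ k i, a k = .inr i → (inf i).Down (sub T [k.1])
  | .tail d n fin idx inf, T => ∃ V ⊆ T, [] ∈ V ∧ ∀ x ∈ V, ∃ i,
      (∃ e : {k // x ++ [k] ∈ V} → Fin (d i), e.Injective) ∧
      ∃ a : {k // [k] ∈ sub T x ∧ k ∉ {k | x ++ [k] ∈ V}} → Fin (n i) ⊕ idx i,
        (∀ k k' i, a k = .inl i → a k' = .inl i → k = k') ∧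
        (∀ k j, a k = .inl j → (fin i j).Down (sub (sub T x) [k.1])) ∧
        ∀ k j, a k = .inr j → (inf i j).Down (sub (sub T x) [k.1])

theorem down_ofNode {N : NodeD Code} {T : Set (List ℕ)} :
    (ofNode N).Down T ↔ NodeDown Down N T ∅ := by
  rw [ofNode, Down]; rfl

theorem down_ofTail {P : ℕ → ℕ × NodeD Code} {T : Set (List ℕ)} :
    (ofTail P).Down T ↔ ∃ V ⊆ T, [] ∈ V ∧ ∀ x ∈ V, ∃ i,
      (∃ e : {k // x ++ [k] ∈ V} → Fin (P i).1, e.Injective) ∧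
      NodeDown Down (P i).2 (sub T x) {k | x ++ [k] ∈ V} := by
  rw [ofTail, Down]; rfl

end Code

/-- A node bounding `S` can be matched into a node for which `S'` has room. -/
theorem NodeDown.exists_match {N : NodeD Code} {S S' : Set (List ℕ)} {E E' : Set ℕ}
    (hD : NodeDown Code.Down N S E) (hU : NodeUp Code.Up N S' E') (hE' : E'.Finite)
    {R : Set (List ℕ) → Set (List ℕ) → Prop}
    (hR : ∀ c, N.Elem c → ∀ k k', [k] ∈ S → [k'] ∈ S' → c.Down (sub S [k]) →
      c.Up (sub S' [k']) → R (sub S [k]) (sub S' [k'])) :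
    ∃ m : ℕ → ℕ, Set.InjOn m {k | [k] ∈ S ∧ k ∉ E} ∧
      ∀ k, [k] ∈ S → k ∉ E → m k ∉ E' ∧ [m k] ∈ S' ∧ R (sub S [k]) (sub S' [m k]) := by
  classical
  obtain ⟨a, ha, hfin, hinf⟩ := hD
  obtain ⟨⟨κ, hκ, hκS⟩, hI⟩ := hU
  have hG : ∀ k, ∃ᶠ x in Filter.atTop, x ∉ E' ∪ Set.range κ ∧ ∀ (hk : [k] ∈ S ∧ k ∉ E) i,
      a ⟨k, hk⟩ = .inr i → [x] ∈ S' ∧ (N.inf i).Up (sub S' [x]) := by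
    intro k
    rw [Nat.frequently_atTop_iff_infinite]
    have hfinite := hE'.union (Set.finite_range κ)
    by_cases h : ∃ (hk : [k] ∈ S ∧ k ∉ E) (i : N.idx), a ⟨k, hk⟩ = .inr i
    · obtain ⟨hk, i, hi⟩ := h
      refine ((hI i).sdiff hfinite).mono fun x hx => ⟨hx.2, fun hk' j hj => ?_⟩
      rw [hi, Sum.inr.injEq] at hj
      exact hj ▸ hx.1
    · exact hfinite.infinite_compl.mono fun x hx => ⟨hx, fun hk i hi => absurd ⟨hk, i, hi⟩ h⟩
  obtain ⟨φ, hφ, hφG⟩ := Filter.extraction_forall_of_frequently hG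
  let m : ℕ → ℕ := fun k => if hk : [k] ∈ S ∧ k ∉ E then
    Sum.elim κ (fun _ => φ k) (a ⟨k, hk⟩) else 0
  have hm : ∀ k (hk : [k] ∈ S ∧ k ∉ E), m k = Sum.elim κ (fun _ => φ k) (a ⟨k, hk⟩) :=
    fun k hk => dif_pos hk
  refine ⟨m, ?_, ?_⟩
  · intro k hk k' hk' h
    rw [hm k hk, hm k' hk'] at h
    rcases hi : a ⟨k, hk⟩ with i | i <;> rcases hi' : a ⟨k', hk'⟩ with i' | i' <;>
      simp only [hi, hi', Sum.elim_inl, Sum.elim_inr] at h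
    · have := ha _ _ i' (hκ h ▸ hi) hi'
      exact congrArg Subtype.val this
    · exact absurd (Or.inr ⟨i, h⟩) (hφG k').1
    · exact absurd (Or.inr ⟨i', h.symm⟩) (hφG k).1
    · exact hφ.injective h
  · intro k hkS hkE
    rw [hm k ⟨hkS, hkE⟩]
    rcases hi : a ⟨k, hkS, hkE⟩ with i | i
    · exact ⟨(hκS i).1, (hκS i).2.1, hR _ (Or.inl ⟨i, rfl⟩) _ _ hkS (hκS i).2.1
        (hfin _ _ hi) (hκS i).2.2⟩
    · have h := (hφG k).2 ⟨hkS, hkE⟩ i hi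
      exact ⟨fun h => (hφG k).1 (Or.inl h), h.1, hR _ (Or.inr ⟨i, rfl⟩) _ _ hkS h.1
        (hinf _ _ hi) h.2⟩

theorem emb_of_down_of_up {c : Code} : ∀ {T T' : Set (List ℕ)}, IsTr T' → c.Down T → c.Up T' →
    Emb T T' := by
  induction c using Code.induction_on with
  | hnode N ih =>
    intro T T' hT' hD hU
    rw [Code.down_ofNode] at hD
    rw [Code.up_ofNode] at hU
    obtain ⟨y, hy, hU⟩ := hU
    have hs := hT'.sub hy
    obtain ⟨m, hm, hmk⟩ := hD.exists_match hU Set.finite_empty (R := Emb)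
      fun c hc k k' _ hk' h h' => ih c hc (hs.sub hk') h h'
    refine EmbStep.emb ⟨y, hy, m, fun k hk k' hk' => hm ⟨hk, id⟩ ⟨hk', id⟩, fun k hk => ?_⟩
    have := (hmk k hk id).2
    rwa [sub_sub] at this
  | htail P ih =>
    classical
    intro T T' hT' hD hU
    rw [Code.down_ofTail] at hD
    rw [Code.up_ofTail] at hU
    obtain ⟨V, hVT, hV0, hV⟩ := hD
    obtain ⟨V', hVT', ⟨v₀, hv₀⟩, hV'⟩ := hU
    refine Emb.of_sim (R := fun A B => ∃ x ∈ V, ∃ w, ∃ v ∈ V', w <+: v ∧ A = sub T x ∧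
      B = sub T' w) ?_ ⟨[], hV0, [], v₀, hv₀, List.nil_prefix, rfl, rfl⟩
    rintro _ _ ⟨x, hx, w, _, hv, ⟨u, rfl⟩, rfl, rfl⟩
    obtain ⟨i, ⟨e, he⟩, hND⟩ := hV x hx
    obtain ⟨y, hy, e', he', hez, hNU⟩ := hV' _ hv i
    have hs := hT'.sub hy
    obtain ⟨m, hm, hmk⟩ := hND.exists_match hNU (Set.finite_range e') (R := Emb)
      fun c hc k k' _ hk' h h' => ih i c hc (hs.sub hk') h h'
    refine ⟨u ++ y, by simpa [List.append_assoc] using hy,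
      fun k => if h : x ++ [k] ∈ V then e' (e ⟨k, h⟩) else m k, ?_, ?_⟩
    · intro k hk k' hk' h
      by_cases hkV : x ++ [k] ∈ V <;> by_cases hkV' : x ++ [k'] ∈ V <;>
        simp only [hkV, hkV', dif_pos, dif_neg, not_false_eq_true] at h
      · exact congrArg Subtype.val (he (he' h))
      · exact absurd ⟨_, h⟩ (hmk k' hk' hkV').1
      · exact absurd ⟨_, h.symm⟩ (hmk k hk hkV).1
      · exact hm ⟨hk, hkV⟩ ⟨hk', hkV'⟩ h
    · intro k hk
      by_cases hkV : x ++ [k] ∈ V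
      · simp only [hkV, dif_pos]
        obtain ⟨z, hz, hpre⟩ := hez (e ⟨k, hkV⟩)
        refine ⟨?_, Or.inl ⟨_, hkV, _, z, hz, hpre, sub_sub _ _ _, ?_⟩⟩
        · obtain ⟨t, rfl⟩ := hpre
          have := hT'.prefix_mem _ _ (hVT' hz)
          simpa [List.append_assoc] using this
        · rw [sub_sub]; simp [List.append_assoc]
      · simp only [hkV, dif_neg, not_false_eq_true]
        obtain ⟨-, h1, h2⟩ := hmk k hk hkV
        refine ⟨by simpa [List.append_assoc] using h1, Or.inr ?_⟩
        rw [sub_sub T' w]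
        rw [sub_sub T'] at h2
        simpa [List.append_assoc] using h2

/-- The tree `T` has a code. -/
def Coded (T : Set (List ℕ)) : Prop := ∃ c : Code, c.Down T ∧ c.Up T

theorem NodeUp.anti {Q : Type*} {U : Q → Set (List ℕ) → Prop} {N : NodeD Q} {S : Set (List ℕ)}
    {E E' : Set ℕ} (h : NodeUp U N S E) (hE : E' ⊆ E) : NodeUp U N S E' := by
  obtain ⟨⟨k, hk, h1⟩, h2⟩ := h
  exact ⟨⟨k, hk, fun i => ⟨fun h => (h1 i).1 (hE h), (h1 i).2⟩⟩, h2⟩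

theorem exists_node {S : Set (List ℕ)} {E : Set ℕ}
    (h : ∀ k, [k] ∈ S → k ∉ E → Coded (sub S [k])) :
    ∃ N, NodeDown Code.Down N S E ∧ NodeUp Code.Up N S E := by
  classical
  choose! c hD hU using h
  let K : Set ℕ := {k | [k] ∈ S ∧ k ∉ E}
  let K₀ : Set ℕ := {k ∈ K | {k' ∈ K | (c k).LE (c k')}.Finite}
  have hK₀ : K₀.Finite := by
    by_contra hinf
    let f := Set.Infinite.natEmbedding K₀ hinf
    have : IsTrans Code Code.LE := ⟨fun _ _ _ h h' => h.trans h'⟩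
    obtain ⟨g, hg | hg⟩ := exists_increasing_or_nonincreasing_subseq Code.LE fun n => c (f n)
    · refine Set.infinite_of_injective_forall_mem (f := fun n => (f (g (n + 1)) : ℕ)) ?_ ?_
        (f (g 0)).2.2
      · intro i j hij
        have := g.injective (f.injective (Subtype.ext hij))
        omega
      · intro n
        exact ⟨(f (g (n + 1))).2.1, hg 0 (n + 1) (Nat.succ_pos n)⟩
    · obtain ⟨i, j, hij, hle⟩ := Code.exists_le_of_seq fun n => c (f (g n))
      exact hg i j hij hle
  have hfin := hK₀.fintype
  let ε := Fintype.equivFin K₀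
  refine ⟨⟨Fintype.card K₀, fun i => c (ε.symm i), K \ K₀, fun i => c i⟩, ⟨fun k =>
    if h : k.1 ∈ K₀ then .inl (ε ⟨k.1, h⟩) else .inr ⟨k.1, k.2, h⟩, ?_, ?_, ?_⟩,
    ⟨fun i => (ε.symm i).1, Subtype.val_injective.comp ε.symm.injective, ?_⟩, ?_⟩
  · intro k k' i h h'
    by_cases hk : k.1 ∈ K₀ <;> by_cases hk' : k'.1 ∈ K₀ <;>
      simp only [hk, hk', dif_pos, dif_neg, not_false_eq_true, reduceCtorEq] at h h'
    rw [← h', Sum.inl.injEq] at h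
    have := congrArg Subtype.val (ε.injective h)
    exact Subtype.ext this
  · intro k i h
    by_cases hk : k.1 ∈ K₀ <;>
      simp only [hk, dif_pos, dif_neg, not_false_eq_true, reduceCtorEq, Sum.inl.injEq] at h
    rw [← h]
    simpa using hD _ k.2.1 k.2.2
  · intro k i h
    by_cases hk : k.1 ∈ K₀ <;>
      simp only [hk, dif_pos, dif_neg, not_false_eq_true, reduceCtorEq, Sum.inr.injEq] at h
    rw [← h]
    exact hD _ k.2.1 k.2.2
  · intro i
    have := (ε.symm i).2.1
    exact ⟨this.2, this.1, hU _ this.1 this.2⟩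
  · rintro ⟨k, hkK, hk⟩
    have : {k' ∈ K | (c k).LE (c k')}.Infinite := fun h => hk ⟨hkK, h⟩
    exact this.mono fun k' hk' => ⟨hk'.1.1, hk'.2 _ (hU _ hk'.1.1 hk'.1.2)⟩

theorem exists_infinite_not_coded {S : Set (List ℕ)} (hS : IsTr S) (hc : ¬ Coded S) :
    ∃ y ∈ S, {k | y ++ [k] ∈ S ∧ ¬ Coded (sub S (y ++ [k]))}.Infinite := by
  classical
  by_contra! hcon
  let U : Set (List ℕ) := {x ∈ S | ¬ Coded (sub S x)}
  let E : List ℕ → Set ℕ := fun x => {k | x ++ [k] ∈ U}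
  have hE : ∀ x ∈ U, (E x).Finite := fun x hx => hcon x hx.1
  have hN : ∀ x, ∃ N, NodeDown Code.Down N (sub S x) (E x) ∧ NodeUp Code.Up N (sub S x) (E x) := by
    intro x
    refine exists_node fun k hk hkE => ?_
    by_contra hcd
    rw [sub_sub] at hcd
    exact hkE ⟨hk, hcd⟩
  choose N hND hNU using hN
  let P : List ℕ → ℕ × NodeD Code := fun x => ((E x).ncard, N x)
  have hz : ∃ z ∈ U, ∀ w ∈ U, z <+: w → ∀ y ∈ U, z <+: y → ∃ y' ∈ U, w <+: y' ∧
      Code.PairLE (P y) (P y') := by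
    by_contra! hz
    choose! w hw hzw y hy hzy hno using hz
    let z : ℕ → List ℕ := fun n => Nat.rec [] (fun _ v => w v) n
    have hz1 : ∀ n, z (n + 1) = w (z n) := fun n => rfl
    have hzU : ∀ n, z n ∈ U := by
      intro n
      induction n with
      | zero => exact ⟨hS.nil_mem, by simpa [z] using hc⟩
      | succ n ih => rw [hz1]; exact hw _ ih
    have hmono : ∀ i j, i ≤ j → z i <+: z j := by
      intro i j hij
      induction j, hij using Nat.le_induction with
      | base => exact List.prefix_rfl
      | succ j _ ih => rw [hz1]; exact ih.trans (hzw _ (hzU j))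
    obtain ⟨i, j, hij, hle⟩ := Code.exists_pairLE_of_seq fun n => P (y (z n))
    exact hno _ (hzU i) _ (hy _ (hzU j)) ((hmono (i + 1) j hij).trans (hzy _ (hzU j))) hle
  obtain ⟨z, hzU, hz⟩ := hz
  obtain ⟨ys, hys⟩ := (Set.to_countable {y ∈ U | z <+: y}).exists_eq_range ⟨z, hzU, List.prefix_rfl⟩
  have hysU : ∀ i, ys i ∈ U ∧ z <+: ys i := fun i => by
    have : ys i ∈ {y ∈ U | z <+: y} := hys ▸ ⟨i, rfl⟩
    exact this
  refine hzU.2 ⟨Code.ofTail fun i => P (ys i), ?_, ?_⟩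
  · rw [Code.down_ofTail]
    refine ⟨{v | z ++ v ∈ U}, fun v hv => hv.1, by simpa using hzU, fun x hx => ?_⟩
    have : z ++ x ∈ Set.range ys := hys ▸ ⟨hx, List.prefix_append _ _⟩
    obtain ⟨i, hi⟩ := this
    refine ⟨i, ?_, ?_⟩
    · have hfin := (hE _ hx).fintype
      have hcard : Fintype.card (E (z ++ x)) = (P (ys i)).1 := by
        simp only [hi, P]
        rw [← Nat.card_coe_set_eq, Nat.card_eq_fintype_card]
      refine ⟨fun k => Fin.cast hcard (Fintype.equivFin _ ⟨k.1, ?_⟩), fun k k' h => ?_⟩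
      · simp [E, List.append_assoc]
      · simpa [Subtype.ext_iff] using h
    · have := hND (ys i)
      rw [sub_sub, ← hi]
      have hEx : {k | x ++ [k] ∈ {v | z ++ v ∈ U}} = E (ys i) := by
        ext k; simp [E, hi, List.append_assoc]
      rw [hEx]
      exact this
  · rw [Code.up_ofTail]
    refine ⟨{v | z ++ v ∈ U}, fun v hv => hv.1, ⟨[], by simpa using hzU⟩, fun x hx i => ?_⟩
    obtain ⟨y', hy'U, ⟨y, rfl⟩, hd, hle⟩ := hz _ hx (List.prefix_append _ _) _ (hysU i).1 (hysU i).2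
    have hfin := (hE _ hy'U).fintype
    have hcard : Fintype.card (E (z ++ x ++ y)) = (P (z ++ x ++ y)).1 := by
      simp only [P]
      rw [← Nat.card_coe_set_eq, Nat.card_eq_fintype_card]
    refine ⟨y, by simpa using hy'U.1, fun j => ((Fintype.equivFin _).symm
      (Fin.cast hcard.symm (Fin.castLE hd j)) : E (z ++ x ++ y)).1, ?_, ?_, ?_⟩
    · intro j j' h
      have h := (Fintype.equivFin _).symm.injective (Subtype.ext h)
      simpa [Fin.ext_iff] using h
    · intro j
      refine ⟨_, ?_, List.prefix_rfl⟩
      have := ((Fintype.equivFin _).symm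
        (Fin.cast hcard.symm (Fin.castLE hd j)) : E (z ++ x ++ y)).2
      simpa [E, List.append_assoc] using this
    · rw [sub_sub, ← List.append_assoc]
      refine NodeUp.mono hle ((hNU (z ++ x ++ y)).anti ?_)
      rintro _ ⟨j, rfl⟩
      exact Subtype.coe_prop _

theorem emb_of_not_coded {T S : Set (List ℕ)} (hS : IsTr S) (hc : ¬ Coded S) : Emb T S := by
  refine Emb.of_sim (R := fun _ B => IsTr B ∧ ¬ Coded B) ?_ ⟨hS, hc⟩
  rintro A B ⟨hB, hBc⟩
  obtain ⟨y, hy, hinf⟩ := exists_infinite_not_coded hB hBc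
  obtain ⟨m, hm, hmk⟩ := Filter.extraction_forall_of_frequently (P := fun _ : ℕ => fun k : ℕ =>
    y ++ [k] ∈ B ∧ ¬ Coded (sub B (y ++ [k]))) fun _ => Nat.frequently_atTop_iff_infinite.2 hinf
  exact ⟨y, hy, m, hm.injective.injOn, fun k _ =>
    ⟨(hmk k).1, Or.inl ⟨hB.sub (hmk k).1, (hmk k).2⟩⟩⟩

end TreeCode

/-! ### Counting codes up to equivalence -/

namespace BQO

variable {Q : Type*}

/-- Countably many colours suffice to make `r` hold between any two elements of `S` of the
same colour. -/
def CountablyMany (r : Q → Q → Prop) (S : Set Q) : Prop :=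
  ∃ F : Q → ℕ, ∀ x ∈ S, ∀ y ∈ S, F x = F y → r x y

theorem exists_finite_basis {r : Q → Q → Prop} (hwqo : ∀ f : ℕ → Q, ∃ i j, i < j ∧ r (f i) (f j))
    (U : Set Q) : ∃ b : Finset Q, (∀ x ∈ b, x ∈ U) ∧ ∀ s ∈ U, ∃ x ∈ b, r x s := by
  by_contra! hcon
  obtain ⟨f, -, hf⟩ := exists_seq_of_forall_finset_exists (· ∈ U) (fun x y => ¬ r x y) hcon
  obtain ⟨i, j, hij, h⟩ := hwqo f
  exact hf i j hij h

theorem CountablyMany.set {r : Q → Q → Prop} {S : Set Q} (hS : CountablyMany r S)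
    (htrans : ∀ a b c, r a b → r b c → r a c)
    (hwqo : ∀ f : ℕ → Q, ∃ i j, i < j ∧ r (f i) (f j)) :
    CountablyMany (fun A B : Set Q => ∀ a ∈ A, ∃ b ∈ B, r a b) {A | A ⊆ S} := by
  classical
  obtain ⟨F, hF⟩ := hS
  choose b hbU hb using fun A : Set Q => exists_finite_basis hwqo {s ∈ S | ∀ a ∈ A, ¬ r s a}
  refine ⟨fun A => Encodable.encode ((b A).image F), fun A hA B hB h a ha => ?_⟩
  have h := Encodable.encode_injective h
  by_contra! hcon
  obtain ⟨x, hx, hxa⟩ := hb B a ⟨hA ha, hcon⟩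
  have hx' : F x ∈ (b A).image F := by
    rw [h]
    exact Finset.mem_image_of_mem F hx
  obtain ⟨y, hy, hyx⟩ := Finset.mem_image.1 hx'
  have hyS := hbU A y hy
  exact hyS.2 a ha (htrans _ _ _ (hF y hyS.1 x (hbU B x hx).1 hyx) hxa)

theorem CountablyMany.nodeD {r : Q → Q → Prop} {S : Set Q} (hS : CountablyMany r S)
    (htrans : ∀ a b c, r a b → r b c → r a c)
    (hwqo : ∀ f : ℕ → Q, ∃ i j, i < j ∧ r (f i) (f j)) :
    CountablyMany (NodeD.LE r) {N | ∀ q, N.Elem q → q ∈ S} := by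
  obtain ⟨G, hG⟩ := hS.set htrans hwqo
  obtain ⟨F, hF⟩ := hS
  refine ⟨fun N => Encodable.encode (List.ofFn fun i => F (N.fin i), G (Set.range N.inf)),
    fun N hN N' hN' h => ?_⟩
  obtain ⟨h1, h2⟩ := Prod.mk.inj (Encodable.encode_injective h)
  constructor
  · have hn : N.n = N'.n := by simpa using congrArg List.length h1
    refine ⟨Fin.cast hn, Fin.cast_injective hn, fun i => ?_⟩
    refine hF _ (hN _ (Or.inl ⟨_, rfl⟩)) _ (hN' _ (Or.inl ⟨_, rfl⟩)) ?_
    have := List.getElem_of_eq h1 (i := i) (by simp)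
    simp only [List.getElem_ofFn] at this
    exact this
  · intro i
    obtain ⟨_, ⟨j, rfl⟩, hj⟩ := hG (Set.range N.inf)
      (by rintro _ ⟨i, rfl⟩; exact hN _ (Or.inr ⟨i, rfl⟩))
      (Set.range N'.inf) (by rintro _ ⟨i, rfl⟩; exact hN' _ (Or.inr ⟨i, rfl⟩)) h2 _ ⟨i, rfl⟩
    exact ⟨j, hj⟩

theorem NodeD.LE.trans {r : Q → Q → Prop} (htrans : ∀ a b c, r a b → r b c → r a c)
    {a b c : NodeD Q} (h : a.LE r b) (h' : b.LE r c) : a.LE r c := by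
  obtain ⟨⟨φ, hφ, h1⟩, h2⟩ := h
  obtain ⟨⟨φ', hφ', h1'⟩, h2'⟩ := h'
  refine ⟨⟨φ' ∘ φ, hφ'.comp hφ, fun i => htrans _ _ _ (h1 i) (h1' _)⟩, fun i => ?_⟩
  obtain ⟨j, hj⟩ := h2 i
  obtain ⟨k, hk⟩ := h2' j
  exact ⟨k, htrans _ _ _ hj hk⟩

end BQO

namespace TreeCode.Code

open BQO

theorem countablyMany_of_children {S : Set Code} (hS : CountablyMany LE S) :
    CountablyMany LE {c | ∀ c', Child c' c → c' ∈ S} := by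
  have htr : ∀ a b c : Code, a.LE b → b.LE c → a.LE c := fun _ _ _ => LE.trans
  have hN := hS.nodeD htr exists_le_of_seq
  have hP : CountablyMany PairLE {p | ∀ q, p.2.Elem q → q ∈ S} := by
    obtain ⟨F, hF⟩ := hN
    refine ⟨fun p => Encodable.encode (p.1, F p.2), fun p hp q hq h => ?_⟩
    obtain ⟨h1, h2⟩ := Prod.mk.inj (Encodable.encode_injective h)
    exact ⟨h1.le, hF _ hp _ hq h2⟩
  have hT := hP.set (fun a b c h h' => ⟨h.1.trans h'.1, h.2.trans htr h'.2⟩) exists_pairLE_of_seq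
  obtain ⟨F, hF⟩ := hN
  obtain ⟨G, hG⟩ := hT
  classical
  refine ⟨fun c => Encodable.encode ((decide (∃ N, ofNode N = c)), F (toNode c),
    G (Set.range (toTail c))), fun c hc c' hc' h => ?_⟩
  have h := Encodable.encode_injective h
  simp only [Prod.mk.injEq, decide_eq_decide] at h
  obtain ⟨h0, h1, h2⟩ := h
  by_cases hn : ∃ N, ofNode N = c
  · obtain ⟨N', rfl⟩ := h0.1 hn
    obtain ⟨N, rfl⟩ := hn
    exact ofNode_le (hF _ (fun q hq => hc q (Or.inl ⟨N, rfl, hq⟩)) _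
      (fun q hq => hc' q (Or.inl ⟨N', rfl, hq⟩)) h1)
  · obtain ⟨P, rfl⟩ := c.ofNode_or_ofTail.resolve_left hn
    obtain ⟨P', rfl⟩ := c'.ofNode_or_ofTail.resolve_left fun h => hn (h0.2 h)
    refine ofTail_le fun i => ?_
    have := hG _ (by
      rintro _ ⟨i, rfl⟩ q hq
      exact hc q (Or.inr ⟨P, i, rfl, hq⟩)) _ (by
      rintro _ ⟨i, rfl⟩ q hq
      exact hc' q (Or.inr ⟨P', i, rfl, hq⟩)) h2 _ ⟨i, rfl⟩
    obtain ⟨_, ⟨j, rfl⟩, hj⟩ := this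
    exact ⟨j, hj⟩

theorem countable_child (c : Code) : {c' | Child c' c}.Countable := by
  have hel : ∀ N : NodeD Code, {c' | N.Elem c'}.Countable := fun N =>
    (Set.countable_range N.fin).union (Set.countable_range N.inf)
  rcases c.ofNode_or_ofTail with ⟨N, rfl⟩ | ⟨P, rfl⟩
  · refine (hel N).mono ?_
    rintro c' (⟨N', h, hc⟩ | ⟨P, i, h, hc⟩)
    · have : N' = N := congrArg toNode h
      exact this ▸ hc
    · exact absurd h.symm (ofNode_ne_ofTail _ _)
  · refine (Set.countable_iUnion fun i => hel (P i).2).mono ?_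
    rintro c' (⟨N', h, hc⟩ | ⟨P', i, h, hc⟩)
    · exact absurd h (ofNode_ne_ofTail _ _)
    · have : P' = P := congrArg toTail h
      exact Set.mem_iUnion.2 ⟨i, this ▸ hc⟩

instance : IsWellFounded Code Child := ⟨wellFounded_child⟩

open Ordinal in
theorem rank_lt (c : Code) : IsWellFounded.rank Child c < ω₁ := by
  induction c using wellFounded_child.induction with
  | _ c ih =>
    rw [IsWellFounded.rank_eq]
    have : Countable {b // Child b c} := (countable_child c).to_subtype
    refine Ordinal.iSup_lt_omega_one fun b => ?_
    exact (Cardinal.isSuccLimit_omega 1).succ_lt (ih b.1 b.2)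

open Ordinal in
theorem countablyMany_rank (β : Ordinal) (hβ : β < ω₁) :
    CountablyMany LE {c | IsWellFounded.rank Child c < β} := by
  induction β using WellFoundedLT.induction with
  | _ β ih =>
    have hγ : ∀ γ : Set.Iio β, CountablyMany LE {c | IsWellFounded.rank Child c = γ.1} := by
      intro γ
      obtain ⟨F, hF⟩ := countablyMany_of_children (ih γ.1 γ.2 (γ.2.trans hβ))
      have : ∀ c, IsWellFounded.rank Child c = γ.1 →
          ∀ c', Child c' c → IsWellFounded.rank Child c' < γ.1 := fun c hc c' h =>
        hc ▸ IsWellFounded.rank_lt_of_rel h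
      exact ⟨F, fun c hc c' hc' => hF c (this c hc) c' (this c' hc')⟩
    choose F hF using hγ
    have hcount : Countable (Set.Iio β) := by
      rw [← Cardinal.mk_le_aleph0_iff, Cardinal.mk_Iio_ordinal, ← Cardinal.lift_aleph0.{1, 0},
        Cardinal.lift_le, ← Cardinal.lt_aleph_one_iff, ← Cardinal.lt_ord, Cardinal.ord_aleph]
      exact hβ
    obtain ⟨e, he⟩ := hcount.exists_injective_nat
    classical
    refine ⟨fun c => if h : IsWellFounded.rank Child c < β then
      Encodable.encode (e ⟨_, h⟩, F ⟨_, h⟩ c) else 0, fun c hc c' hc' h => ?_⟩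
    have hc : IsWellFounded.rank Child c < β := hc
    have hc' : IsWellFounded.rank Child c' < β := hc'
    simp only [dif_pos hc, dif_pos hc'] at h
    obtain ⟨h1, h2⟩ := Prod.mk.inj (Encodable.encode_injective h)
    have h1 := Subtype.ext_iff.1 (he h1)
    have : ∀ γ (hγ : γ < β), IsWellFounded.rank Child c' = γ → F ⟨γ, hγ⟩ c = F ⟨_, hc'⟩ c' →
        IsWellFounded.rank Child c = γ → c.LE c' := by
      rintro γ hγ rfl h2 h1
      exact hF ⟨_, hγ⟩ c h1 c' rfl h2
    exact this _ hc h1.symm h2 rfl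

open Ordinal in
/-- A complete invariant with `ℵ₁` many values. -/
theorem exists_key : ∃ F : Code → Set.Iio (ω₁ : Ordinal.{0}) × ℕ,
    ∀ c c', F c = F c' → c.LE c' := by
  choose F hF using countablyMany_rank
  have hs : ∀ {γ : Ordinal}, γ < ω₁ → Order.succ γ < ω₁ := (Cardinal.isSuccLimit_omega 1).succ_lt
  refine ⟨fun c => (⟨_, rank_lt c⟩, F _ (hs (rank_lt c)) c), fun c c' h => ?_⟩
  obtain ⟨h1, h2⟩ := Prod.mk.inj h
  have h1 := Subtype.ext_iff.1 h1
  have : ∀ γ (hγ : γ < ω₁), IsWellFounded.rank Child c' = γ →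
      F _ (hs hγ) c = F _ (hs (rank_lt c')) c' → IsWellFounded.rank Child c = γ → c.LE c' := by
    rintro γ hγ rfl h2 h1
    exact hF _ (hs hγ) c (by simp [h1]) c' (by simp) h2
  exact this _ (rank_lt c) h1.symm h2 rfl

end TreeCode.Code

namespace TreeCode

open Ordinal in
theorem exists_tree_key : ∃ F : Set (List ℕ) → Option (Set.Iio (ω₁ : Ordinal.{0}) × ℕ),
    ∀ T T', IsTr T → IsTr T' → F T = F T' → Emb T T' := by
  classical
  obtain ⟨F, hF⟩ := Code.exists_key
  refine ⟨fun T => if h : Coded T then some (F h.choose) else none, fun T T' hT hT' h => ?_⟩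
  by_cases h' : Coded T'
  · by_cases hc : Coded T
    · simp only [dif_pos hc, dif_pos h', Option.some.injEq] at h
      exact emb_of_down_of_up hT' hc.choose_spec.1 (hF _ _ h _ h'.choose_spec.2)
    · simp [hc, h'] at h
  · exact emb_of_not_coded hT' h'

end TreeCode

/-! ### From trees of sequences to graphs -/

namespace TreeCode

/-- The images of the nodes under the embedding described step by step by `y` and `m`. -/
def embMap (y : Set (List ℕ) → Set (List ℕ) → List ℕ) (m : Set (List ℕ) → Set (List ℕ) → ℕ → ℕ) :
    List ℕ → Set (List ℕ) → Set (List ℕ) → List ℕ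
  | [], A, B => y A B
  | k :: x, A, B => y A B ++ [m A B k] ++ embMap y m x (sub A [k]) (sub B (y A B ++ [m A B k]))

/-- The maps on the kids in the embedding described step by step by `y` and `m`. -/
def embKid (y : Set (List ℕ) → Set (List ℕ) → List ℕ) (m : Set (List ℕ) → Set (List ℕ) → ℕ → ℕ) :
    List ℕ → Set (List ℕ) → Set (List ℕ) → ℕ → ℕ
  | [], A, B => m A B
  | k :: x, A, B => embKid y m x (sub A [k]) (sub B (y A B ++ [m A B k]))

theorem Emb.exists_map {T S : Set (List ℕ)} (hT : IsTr T) (h : Emb T S) :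
    ∃ (φ : List ℕ → List ℕ) (m : List ℕ → ℕ → ℕ), (∀ x ∈ T, φ x ∈ S) ∧
      (∀ x ∈ T, Set.InjOn (m x) {k | x ++ [k] ∈ T}) ∧
      ∀ x k, x ++ [k] ∈ T → φ x ++ [m x k] <+: φ (x ++ [k]) := by
  have hch : ∀ A B, ∃ (y : List ℕ) (m : ℕ → ℕ), Emb A B → y ∈ B ∧ Set.InjOn m {k | [k] ∈ A} ∧
      ∀ k, [k] ∈ A → y ++ [m k] ∈ B ∧ Emb (sub A [k]) (sub B (y ++ [m k])) := by
    intro A B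
    by_cases h : Emb A B
    · obtain ⟨y, hy, m, hm⟩ := h.step
      exact ⟨y, m, fun _ => ⟨hy, hm⟩⟩
    · exact ⟨[], id, fun h' => absurd h' h⟩
  choose y m hym using hch
  have key : ∀ x A B, IsTr A → Emb A B → x ∈ A → embMap y m x A B ∈ B ∧
      Set.InjOn (embKid y m x A B) {k | x ++ [k] ∈ A} ∧
      ∀ k, x ++ [k] ∈ A →
        embMap y m x A B ++ [embKid y m x A B k] <+: embMap y m (x ++ [k]) A B := by
    intro x
    induction x with
    | nil =>
      intro A B _ hAB _
      obtain ⟨h1, h2, h3⟩ := hym A B hAB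
      exact ⟨h1, h2, fun k hk => ⟨_, rfl⟩⟩
    | cons k x ih =>
      intro A B hA hAB hx
      obtain ⟨h1, h2, h3⟩ := hym A B hAB
      have hk : [k] ∈ A := hA.prefix_mem [k] x hx
      obtain ⟨g1, g2, g3⟩ := ih (sub A [k]) (sub B (y A B ++ [m A B k])) (hA.sub hk) (h3 k hk).2 hx
      refine ⟨g1, g2, fun j hj => ?_⟩
      have := g3 j hj
      simp only [embMap, embKid, List.cons_append, List.append_assoc] at this ⊢
      simpa using this
  exact ⟨fun x => embMap y m x T S, fun x => embKid y m x T S, fun x hx => (key x T S hT h hx).1,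
    fun x hx => (key x T S hT h hx).2.1, fun x k hk =>
      (key x T S hT h (hT.prefix_mem x [k] hk)).2.2 k hk⟩

theorem prefix_trichotomy (z z' : List ℕ) : z = z' ∨ (∃ k, z ++ [k] <+: z') ∨
    (∃ k, z' ++ [k] <+: z) ∨ ∃ x k k', k ≠ k' ∧ x ++ [k] <+: z ∧ x ++ [k'] <+: z' := by
  induction z generalizing z' with
  | nil =>
    cases z' with
    | nil => exact Or.inl rfl
    | cons k z' => exact Or.inr (Or.inl ⟨k, by simp⟩)
  | cons a z ih =>
    cases z' with
    | nil => exact Or.inr (Or.inr (Or.inl ⟨a, by simp⟩))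
    | cons b z' =>
      by_cases hab : a = b
      · subst hab
        rcases ih z' with h | ⟨k, h⟩ | ⟨k, h⟩ | ⟨x, k, k', hne, h, h'⟩
        · exact Or.inl (by rw [h])
        · exact Or.inr (Or.inl ⟨k, by simpa using h⟩)
        · exact Or.inr (Or.inr (Or.inl ⟨k, by simpa using h⟩))
        · exact Or.inr (Or.inr (Or.inr ⟨a :: x, k, k', hne, by simpa using h, by simpa using h'⟩))
      · exact Or.inr (Or.inr (Or.inr ⟨[], a, b, hab, by simp, by simp⟩))

/-- The segment of nodes belonging to the image of `z`. -/
def seg (φ : List ℕ → List ℕ) (m : List ℕ → ℕ → ℕ) (z : List ℕ) : Set (List ℕ) :=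
  {r | r <+: φ z ∧ ∀ x k, x ++ [k] <+: z → φ x ++ [m x k] <+: r}

theorem IsTr.mem_of_prefix {T : Set (List ℕ)} (hT : IsTr T) {x z : List ℕ} (h : x <+: z)
    (hz : z ∈ T) : x ∈ T := by
  obtain ⟨y, rfl⟩ := h
  exact hT.prefix_mem x y hz

section

variable {T : Set (List ℕ)} {φ : List ℕ → List ℕ} {m : List ℕ → ℕ → ℕ}

theorem map_prefix (hT : IsTr T) (hφ : ∀ x k, x ++ [k] ∈ T → φ x ++ [m x k] <+: φ (x ++ [k]))
    {x z : List ℕ} (hz : z ∈ T) (h : x <+: z) : φ x <+: φ z := by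
  obtain ⟨y, rfl⟩ := h
  induction y using List.reverseRecOn with
  | nil => simp
  | append_singleton y k ih =>
    rw [← List.append_assoc] at hz ⊢
    exact (ih (hT.prefix_mem _ _ hz)).trans ((List.prefix_append _ _).trans (hφ _ _ hz))

theorem map_mem_seg (hT : IsTr T) (hφ : ∀ x k, x ++ [k] ∈ T → φ x ++ [m x k] <+: φ (x ++ [k]))
    {z : List ℕ} (hz : z ∈ T) : φ z ∈ seg φ m z :=
  ⟨List.prefix_rfl, fun x k h => (hφ x k (hT.mem_of_prefix h hz)).trans (map_prefix hT hφ hz h)⟩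

theorem not_append_prefix {x r : List ℕ} {k : ℕ} (h : x ++ [k] <+: r) (h' : r <+: x) : False := by
  have := (h.trans h').length_le
  simp at this

theorem eq_of_mem_seg (hT : IsTr T) (hm : ∀ x ∈ T, Set.InjOn (m x) {k | x ++ [k] ∈ T})
    {z z' r : List ℕ} (hz : z ∈ T) (hz' : z' ∈ T)
    (hr : r ∈ seg φ m z) (hr' : r ∈ seg φ m z') : z = z' := by
  rcases prefix_trichotomy z z' with h | ⟨k, h⟩ | ⟨k, h⟩ | ⟨x, k, k', hne, h, h'⟩
  · exact h
  · exact (not_append_prefix (hr'.2 _ _ h) hr.1).elim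
  · exact (not_append_prefix (hr.2 _ _ h) hr'.1).elim
  · have h1 := hr.2 _ _ h
    have h2 := hr'.2 _ _ h'
    have h3 := List.prefix_of_prefix_length_le h1 h2 (by simp)
    simp only [List.prefix_append_right_inj, List.cons_prefix_cons, List.nil_prefix, and_true] at h3
    have hx := hT.mem_of_prefix h hz
    exact absurd (hm x (hT.prefix_mem x [k] hx) hx (hT.mem_of_prefix h' hz') h3) hne

theorem eq_or_mem_seg (hT : IsTr T) (hφ : ∀ x k, x ++ [k] ∈ T → φ x ++ [m x k] <+: φ (x ++ [k]))
    {x r : List ℕ} {k : ℕ} (hx : x ++ [k] ∈ T) (h : φ x <+: r) (h' : r <+: φ (x ++ [k])) :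
    r = φ x ∨ r ∈ seg φ m (x ++ [k]) := by
  by_cases hr : r = φ x
  · exact Or.inl hr
  refine Or.inr ⟨h', fun x' k' hp => ?_⟩
  rcases List.prefix_concat_iff.1 hp with he | hp
  · obtain ⟨rfl, he⟩ := List.append_inj' he rfl
    obtain rfl : k' = k := by simpa using he
    refine List.prefix_of_prefix_length_le (hφ _ _ hx) h' ?_
    have := h.length_le
    have : (φ x').length ≠ r.length := fun hl => hr (h.eq_of_length hl).symm
    simp
    omega
  · have hxT := hT.prefix_mem _ _ hx
    exact ((hφ x' k' (hT.mem_of_prefix hp hxT)).trans (map_prefix hT hφ hxT hp)).trans h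

end

theorem path_support {W : Type*} {H : SimpleGraph W} (hH : H.IsAcyclic) {S : Set (List ℕ)}
    (hS : IsTr S) {v : List ℕ → W} (hv : ∀ x k, x ++ [k] ∈ S → H.Adj (v x) (v (x ++ [k])))
    {r r' : List ℕ} (hr : r' ∈ S) (h : r <+: r') {p : H.Walk (v r) (v r')} (hp : p.IsPath)
    {w : W} (hw : w ∈ p.support) : ∃ q, r <+: q ∧ q <+: r' ∧ w = v q := by
  classical
  have key : ∃ p : H.Walk (v r) (v r'), ∀ w ∈ p.support, ∃ q, r <+: q ∧ q <+: r' ∧ w = v q := by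
    obtain ⟨s, rfl⟩ := h
    clear hp hw p
    induction s using List.reverseRecOn with
    | nil =>
      rw [List.append_nil]
      exact ⟨.nil, fun w hw => ⟨r, List.prefix_rfl, List.prefix_rfl, by simpa using hw⟩⟩
    | append_singleton s k ih =>
      rw [← List.append_assoc] at hr ⊢
      obtain ⟨p, hp⟩ := ih (hS.prefix_mem _ _ hr)
      refine ⟨p.concat (hv _ _ hr), fun w hw => ?_⟩
      rw [SimpleGraph.Walk.support_concat, List.mem_append, List.mem_singleton] at hw
      rcases hw with hw | rfl
      · obtain ⟨q, h1, h2, h3⟩ := hp w hw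
        exact ⟨q, h1, h2.trans (List.prefix_append _ _), h3⟩
      · exact ⟨_, (List.prefix_append _ _).trans (List.prefix_append _ _), List.prefix_rfl, rfl⟩
  obtain ⟨p', hp'⟩ := key
  have := (hH.subsingleton_path _ _).elim ⟨p, hp⟩ p'.toPath
  have hpe : p = p'.bypass := congrArg Subtype.val this
  rw [hpe] at hw
  exact hp' w (p'.support_bypass_subset_support hw)

theorem topMinorLE_of_emb {V W : Type*} {G : SimpleGraph V} {H : SimpleGraph W} (hH : H.IsTree)
    {T S : Set (List ℕ)} (hT : IsTr T) (hS : IsTr S) {l : V → List ℕ} (hl : ∀ a, l a ∈ T)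
    (hlinj : l.Injective)
    (hladj : ∀ a b, G.Adj a b → (∃ k, l b = l a ++ [k]) ∨ ∃ k, l a = l b ++ [k])
    {v : List ℕ → W} (hvinj : Set.InjOn v S)
    (hv : ∀ x k, x ++ [k] ∈ S → H.Adj (v x) (v (x ++ [k]))) (h : Emb T S) : TopMinorLE G H := by
  classical
  obtain ⟨φ, m, hφS, hm, hφ⟩ := h.exists_map hT
  choose P hP hPu using hH.existsUnique_path
  have hsupp : ∀ a b, G.Adj a b → ∃ c d, (s(a, b) = s(c, d)) ∧ (∃ k, l c = l d ++ [k]) ∧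
      ∀ w ∈ (P (v (φ (l a))) (v (φ (l b)))).support, w = v (φ (l d)) ∨
        ∃ r ∈ seg φ m (l c), r ∈ S ∧ w = v r := by
    have main : ∀ a b, (∃ k, l b = l a ++ [k]) →
        ∀ w ∈ (P (v (φ (l a))) (v (φ (l b)))).support, w = v (φ (l a)) ∨
          ∃ r ∈ seg φ m (l b), r ∈ S ∧ w = v r := by
      rintro a b ⟨k, hk⟩ w hw
      have hb : l a ++ [k] ∈ T := hk ▸ hl b
      obtain ⟨q, h1, h2, rfl⟩ := path_support hH.isAcyclic hS hv (hφS _ (hl b))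
        (map_prefix hT hφ (hl b) (hk ▸ List.prefix_append _ _)) (hP _ _) hw
      have hqS := hS.mem_of_prefix h2 (hφS _ (hl b))
      rw [hk] at h2 ⊢
      rcases eq_or_mem_seg hT hφ hb h1 h2 with rfl | h
      · exact Or.inl rfl
      · exact Or.inr ⟨q, h, hqS, rfl⟩
    intro a b hab
    rcases hladj a b hab with hk | hk
    · exact ⟨b, a, Sym2.eq_swap, hk, main a b hk⟩
    · refine ⟨a, b, rfl, hk, fun w hw => main b a hk w ?_⟩
      rwa [← hPu _ _ _ (hP _ _).reverse, SimpleGraph.Walk.support_reverse, List.mem_reverse]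
  have hmem : ∀ a r, r ∈ S → v (φ (l a)) = v r → r = φ (l a) := fun a r hr h =>
    (hvinj (hφS _ (hl a)) hr h).symm
  have hseg : ∀ a c, φ (l a) ∈ seg φ m (l c) → a = c := fun a c h =>
    hlinj (eq_of_mem_seg hT hm (hl a) (hl c) (map_mem_seg hT hφ (hl a)) h)
  refine ⟨⟨fun a => v (φ (l a)), fun a b hab => ?_, fun a b _ => P _ _, fun a b _ => hP _ _,
    fun a b _ => (hPu _ _ _ (hP _ _).reverse).symm, ?_, ?_⟩⟩
  · refine hseg a b ?_
    rw [hmem b _ (hφS _ (hl a)) hab.symm]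
    exact map_mem_seg hT hφ (hl b)
  · intro a b hab w hw hwa hwb x hx
    obtain ⟨c, d, hcd, -, hc⟩ := hsupp a b hab
    have hno : w ≠ v (φ (l c)) ∧ w ≠ v (φ (l d)) := by
      rcases Sym2.eq_iff.1 hcd with ⟨rfl, rfl⟩ | ⟨rfl, rfl⟩
      · exact ⟨hwa, hwb⟩
      · exact ⟨hwb, hwa⟩
    rcases hc w hw with h | ⟨r, hr, hrS, rfl⟩
    · exact hno.2 h
    · obtain rfl := hmem x r hrS hx
      obtain rfl := hseg x c hr
      exact hno.1 rfl
  · intro a b a' b' hab hab' hne w hw hw'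
    obtain ⟨c, d, hcd, ⟨k, hk⟩, hc⟩ := hsupp a b hab
    obtain ⟨c', d', hcd', ⟨k', hk'⟩, hc'⟩ := hsupp a' b' hab'
    have hyes : w = v (φ (l c)) ∨ w = v (φ (l d)) → w = v (φ (l a)) ∨ w = v (φ (l b)) := by
      rcases Sym2.eq_iff.1 hcd with ⟨rfl, rfl⟩ | ⟨rfl, rfl⟩
      · exact id
      · exact Or.symm
    refine hyes ?_
    rcases hc w hw with h | ⟨r, hr, hrS, rfl⟩
    · exact Or.inr h
    rcases hc' _ hw' with h | ⟨r', hr', hrS', h⟩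
    · obtain rfl := hmem d' r hrS h.symm
      obtain rfl := hseg d' c hr
      exact Or.inl rfl
    · obtain rfl := hvinj hrS hrS' h
      obtain rfl : c = c' := hlinj (eq_of_mem_seg hT hm (hl c) (hl c') hr hr')
      obtain rfl : d = d' := hlinj (List.append_inj' (hk.symm.trans hk') rfl).1
      exact absurd (hcd.trans hcd'.symm) hne

/-- The tree of paths from `0`. -/
def paths (G : SimpleGraph ℕ) : Set (List ℕ) := {p | (0 :: p).IsChain G.Adj ∧ (0 :: p).Nodup}

theorem isTr_paths (G : SimpleGraph ℕ) : IsTr (paths G) := by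
  refine ⟨by simp [paths], fun x y h => ?_⟩
  obtain ⟨h1, h2⟩ := h
  rw [← List.cons_append] at h1 h2
  exact ⟨h1.left_of_append, h2.of_append_left⟩

theorem exists_path_of_mem_paths {G : SimpleGraph ℕ} {p : List ℕ} (hp : p ∈ paths G) :
    ∃ w : G.Walk 0 ((0 :: p).getLast (List.cons_ne_nil 0 p)), w.IsPath ∧ w.support = 0 :: p := by
  have h := SimpleGraph.Walk.support_ofSupport (List.cons_ne_nil 0 p) hp.1
  exact ⟨.ofSupport _ _ hp.1, SimpleGraph.Walk.IsPath.mk' ((congrArg List.Nodup h).mpr hp.2), h⟩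

theorem injOn_paths {G : SimpleGraph ℕ} (hG : G.IsTree) :
    Set.InjOn (fun p : List ℕ => (0 :: p).getLast (List.cons_ne_nil 0 p)) (paths G) := by
  intro p hp q hq h
  obtain ⟨w, hw, hws⟩ := exists_path_of_mem_paths hp
  obtain ⟨w', hw', hws'⟩ := exists_path_of_mem_paths hq
  simp only at h
  have : ∀ a b (w : G.Walk 0 a) (w' : G.Walk 0 b), w.IsPath → w'.IsPath → a = b →
      w.support = w'.support := by
    rintro a _ w w' hw hw' rfl
    rw [(hG.existsUnique_path 0 a).unique hw hw']
  have := this _ _ w w' hw hw' h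
  rw [hws, hws'] at this
  simpa using this

theorem adj_paths {G : SimpleGraph ℕ} {x : List ℕ} {k : ℕ} (h : x ++ [k] ∈ paths G) :
    G.Adj ((0 :: x).getLast (by simp)) ((0 :: (x ++ [k])).getLast (by simp)) := by
  have h1 := h.1
  rw [← List.cons_append] at h1
  have := h1.rel_getLast_head_of_append (by simp) (by simp)
  simpa using this

theorem exists_label {G : SimpleGraph ℕ} (hG : G.IsTree) : ∃ l : ℕ → List ℕ, (∀ a, l a ∈ paths G) ∧
    l.Injective ∧ ∀ a b, G.Adj a b → (∃ k, l b = l a ++ [k]) ∨ ∃ k, l a = l b ++ [k] := by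
  choose P hP hPu using fun a => hG.existsUnique_path 0 a
  have hs : ∀ a, (P a).support = 0 :: (P a).support.tail := fun a =>
    (P a).cons_tail_support.symm
  refine ⟨fun a => (P a).support.tail, fun a => ⟨?_, ?_⟩, fun a b hab => ?_, fun a b hab => ?_⟩
  · rw [← hs]; exact (P a).isChain_adj_support
  · rw [← hs]; exact (hP a).support_nodup
  · have : (P a).support = (P b).support := by
      rw [hs a, hs b]
      exact congrArg _ hab
    rw [← (P a).getLast_support, ← (P b).getLast_support]
    simp only [this]
  · by_cases h : a ∈ (P b).support
    · refine Or.inl ⟨b, ?_⟩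
      dsimp only
      rw [hG.isAcyclic.path_concat (hP a) (hP b) hab h, SimpleGraph.Walk.support_concat, hs a]
      rfl
    · refine Or.inr ⟨a, ?_⟩
      dsimp only
      have := hG.isAcyclic.mem_support_of_ne_mem_support_of_adj_of_isPath (hP a) (hP b) hab h
      rw [hG.isAcyclic.path_concat (hP b) (hP a) hab.symm this, SimpleGraph.Walk.support_concat,
        hs b]
      rfl

theorem topMinorLE_of_emb_paths {G H : SimpleGraph ℕ} (hG : G.IsTree) (hH : H.IsTree)
    (h : Emb (paths G) (paths H)) : TopMinorLE G H := by
  obtain ⟨l, hl, hinj, hadj⟩ := exists_label hG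
  exact topMinorLE_of_emb hH (isTr_paths G) (isTr_paths H) hl hinj hadj (injOn_paths hH)
    (fun _ _ h => adj_paths h) h

end TreeCode

/-! ### Betweenness and the lower bound -/

namespace TreeCode

open SimpleGraph

/-- `b` separates `a` from `c`. -/
def Btw {V : Type*} (G : SimpleGraph V) (a b c : V) : Prop := ∀ p : G.Walk a c, b ∈ p.support

/-- There is an injective map preserving betweenness. -/
def BtwLE {V W : Type*} (G : SimpleGraph V) (H : SimpleGraph W) : Prop :=
  ∃ φ : V → W, φ.Injective ∧ ∀ a b c, Btw G a b c → Btw H (φ a) (φ b) (φ c)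

theorem BtwLE.refl {V : Type*} (G : SimpleGraph V) : BtwLE G G :=
  ⟨id, Function.injective_id, fun _ _ _ => id⟩

theorem BtwLE.trans {U V W : Type*} {F : SimpleGraph U} {G : SimpleGraph V} {H : SimpleGraph W}
    (h : BtwLE F G) (h' : BtwLE G H) : BtwLE F H := by
  obtain ⟨φ, hφ, hb⟩ := h
  obtain ⟨φ', hφ', hb'⟩ := h'
  exact ⟨φ' ∘ φ, hφ'.comp hφ, fun a b c h => hb' _ _ _ (hb _ _ _ h)⟩

section

variable {V W : Type*} {G : SimpleGraph V} {H : SimpleGraph W}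

/-- The concatenation of the paths assigned to the edges of a walk. -/
def embWalk (f : TopMinorEmb G H) : ∀ {a b : V}, G.Walk a b → H.Walk (f.toFun a) (f.toFun b)
  | _, _, .nil => .nil
  | _, _, .cons h p => (f.path h).append (embWalk f p)

theorem mem_support_embWalk (f : TopMinorEmb G H) {a b : V} (p : G.Walk a b) {c : V}
    (hc : c ∈ p.support) : f.toFun c ∈ (embWalk f p).support := by
  induction p with
  | nil =>
    obtain rfl := List.mem_singleton.1 hc
    exact Walk.start_mem_support _
  | cons h p ih =>
    rw [embWalk, Walk.mem_support_append_iff]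
    rw [Walk.support_cons, List.mem_cons] at hc
    rcases hc with rfl | hc
    · exact Or.inl (Walk.start_mem_support _)
    · exact Or.inr (ih hc)

theorem exists_edge_of_mem_embWalk (f : TopMinorEmb G H) {a b : V} (p : G.Walk a b) {w : W}
    (hw : w ∈ (embWalk f p).support) : w = f.toFun a ∨ ∃ (x y : V) (h : G.Adj x y),
      x ∈ p.support ∧ y ∈ p.support ∧ w ∈ (f.path h).support := by
  induction p with
  | nil => exact Or.inl (by simpa [embWalk] using hw)
  | @cons u v c h p ih =>
    rw [embWalk, Walk.mem_support_append_iff] at hw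
    have hv : v ∈ (Walk.cons h p).support := by simp
    rcases hw with hw | hw
    · exact Or.inr ⟨_, _, h, Walk.start_mem_support _, hv, hw⟩
    · rcases ih hw with rfl | ⟨x, y, hxy, hx, hy, hw⟩
      · exact Or.inr ⟨_, _, h, Walk.start_mem_support _, hv, Walk.end_mem_support _⟩
      · exact Or.inr ⟨x, y, hxy, by simp [hx], by simp [hy], hw⟩

theorem isPath_embWalk (f : TopMinorEmb G H) {a b : V} (p : G.Walk a b) (hp : p.IsPath) :
    (embWalk f p).IsPath := by
  induction p with
  | nil => simp [embWalk]
  | @cons u v c h p ih =>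
    rw [Walk.cons_isPath_iff] at hp
    have ihp := ih hp.1
    rw [embWalk, Walk.isPath_def, Walk.support_append, List.nodup_append']
    refine ⟨(f.path_isPath h).support_nodup, ihp.support_nodup.tail, ?_⟩
    intro w hw hw'
    have hnot : f.toFun v ∉ (embWalk f p).support.tail := by
      have := ihp.support_nodup
      rw [← Walk.cons_tail_support, List.nodup_cons] at this
      exact this.1
    have hwv : w ≠ f.toFun v := fun h => hnot (h ▸ hw')
    rcases exists_edge_of_mem_embWalk f p (List.mem_of_mem_tail hw') with
      h1 | ⟨x, y, hxy, hx, hy, hwx⟩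
    · exact hwv h1
    · have hne : s(u, v) ≠ s(x, y) := by
        intro he
        rcases Sym2.eq_iff.1 he with ⟨rfl, rfl⟩ | ⟨rfl, rfl⟩
        · exact hp.2 hx
        · exact hp.2 hy
      have h1 := (f.internally_disjoint h hxy hne w hw hwx).resolve_right hwv
      rcases f.internally_disjoint hxy h hne.symm w hwx hw with h2 | h2
      · exact hp.2 (f.inj (h1.symm.trans h2) ▸ hx)
      · exact hp.2 (f.inj (h1.symm.trans h2) ▸ hy)

theorem btwLE_of_topMinorLE (hG : G.IsTree) (hH : H.IsTree) (h : TopMinorLE G H) : BtwLE G H := by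
  classical
  obtain ⟨f⟩ := h
  refine ⟨f.toFun, f.inj, fun a b c habc q => ?_⟩
  obtain ⟨p, hp, -⟩ := hG.existsUnique_path a c
  have h1 := mem_support_embWalk f p (habc p)
  have h2 : embWalk f p = q.bypass := congrArg Subtype.val
    ((hH.isAcyclic.subsingleton_path _ _).elim ⟨_, isPath_embWalk f p hp⟩ q.toPath)
  rw [h2] at h1
  exact q.support_bypass_subset_support h1

end

/-- The graph of a tree of sequences given by a labelling of its vertices. -/
def labelGraph {V : Type*} (l : V → List ℕ) : SimpleGraph V where
  Adj a b := (∃ k, l b = l a ++ [k]) ∨ ∃ k, l a = l b ++ [k]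
  symm := ⟨fun _ _ => Or.symm⟩
  loopless := ⟨fun a h => by rcases h with ⟨k, h⟩ | ⟨k, h⟩ <;> simp at h⟩

section

variable {V : Type*} {l : V → List ℕ}

theorem exists_walk_up (hl : l.Injective) (hT : IsTr (Set.range l)) {a c : V}
    (h : l a <+: l c) : ∃ p : (labelGraph l).Walk a c, ∀ w ∈ p.support, l w <+: l c := by
  obtain ⟨s, hs⟩ := h
  induction s using List.reverseRecOn generalizing c with
  | nil =>
    rw [List.append_nil] at hs
    obtain rfl := hl hs
    exact ⟨.nil, fun w hw => by simp_all⟩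
  | append_singleton s k ih =>
    rw [← List.append_assoc] at hs
    obtain ⟨c', hc'⟩ := hT.prefix_mem (l a ++ s) [k] ⟨c, hs.symm⟩
    obtain ⟨p, hp⟩ := ih hc'.symm
    have hcc : l c = l c' ++ [k] := by rw [hc', hs]
    have hadj : (labelGraph l).Adj c' c := Or.inl ⟨k, hcc⟩
    refine ⟨p.concat hadj, fun w hw => ?_⟩
    rw [Walk.support_concat, List.mem_append, List.mem_singleton] at hw
    rcases hw with hw | rfl
    · exact (hp w hw).trans (hcc ▸ List.prefix_append _ _)
    · exact List.prefix_rfl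

theorem exists_dart (hl : l.Injective) {a b c : V} (ha : ¬ l b <+: l a) (hc : l b <+: l c)
    (p : (labelGraph l).Walk a c) : ∃ d ∈ p.darts, d.snd = b ∧ ∃ k, l b = l d.fst ++ [k] := by
  obtain ⟨d, hd, h1, h2⟩ := p.exists_boundary_dart {w | ¬ l b <+: l w} ha (by simpa using hc)
  have h1 : ¬ l b <+: l d.fst := h1
  have h2 : l b <+: l d.snd := by simpa using h2
  rcases d.adj with ⟨k, hk⟩ | ⟨k, hk⟩
  · rw [hk, List.prefix_concat_iff] at h2
    rcases h2 with h2 | h2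
    · exact ⟨d, hd, hl (hk.trans h2.symm), k, h2⟩
    · exact absurd h2 h1
  · exact absurd (h2.trans (hk ▸ List.prefix_append _ _)) h1

theorem btw_of_prefix (hl : l.Injective) {a b c : V} (hab : l a <+: l b) (hbc : l b <+: l c) :
    Btw (labelGraph l) a b c := by
  intro p
  by_cases h : l b <+: l a
  · have : l a = l b := hab.eq_of_length_le h.length_le
    obtain rfl := hl this
    exact p.start_mem_support
  · obtain ⟨d, hd, rfl, -⟩ := exists_dart hl h hbc p
    exact p.dart_snd_mem_support_of_mem_darts hd

theorem btw_root (hl : l.Injective) {r a c : V} (hr : l r = []) {i j : ℕ} (hij : i ≠ j)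
    (ha : [i] <+: l a) (hc : [j] <+: l c) (hT : IsTr (Set.range l)) :
    Btw (labelGraph l) a r c := by
  intro p
  obtain ⟨b, hb⟩ := hT.mem_of_prefix hc ⟨c, rfl⟩
  obtain ⟨d, hd, -, k, hk⟩ := exists_dart hl (a := a) (b := b) (c := c) (fun h => by
    rw [hb] at h
    have := List.prefix_of_prefix_length_le ha h (by simp)
    exact hij (by simpa using this)) (hb ▸ hc) p
  have : l d.fst = [] := by
    rw [hb] at hk
    have := congrArg List.length hk
    simp only [List.length_append, List.length_singleton] at this
    exact List.eq_nil_of_length_eq_zero (by omega)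
  obtain rfl := hl (this.trans hr.symm)
  exact p.dart_fst_mem_support_of_mem_darts hd

theorem Btw.prefix_of_prefix (hl : l.Injective) (hT : IsTr (Set.range l)) {a b c : V}
    (h : Btw (labelGraph l) a b c) (hac : l a <+: l c) : l b <+: l c := by
  obtain ⟨p, hp⟩ := exists_walk_up hl hT hac
  exact hp b (h p)

theorem Btw.prefix_or_prefix (hl : l.Injective) (hT : IsTr (Set.range l)) {a b c : V}
    (h : Btw (labelGraph l) a b c) : l b <+: l a ∨ l b <+: l c := by
  obtain ⟨r, hr⟩ := hT.nil_mem
  obtain ⟨p, hp⟩ := exists_walk_up hl hT (a := r) (c := a) (by simp [hr])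
  obtain ⟨q, hq⟩ := exists_walk_up hl hT (a := r) (c := c) (by simp [hr])
  have := h (p.reverse.append q)
  rw [Walk.mem_support_append_iff, Walk.support_reverse, List.mem_reverse] at this
  exact this.imp (hp b) (hq b)

theorem isTree_labelGraph (hl : l.Injective) (hT : IsTr (Set.range l)) :
    (labelGraph l).IsTree := by
  obtain ⟨r, hr⟩ := hT.nil_mem
  have hreach : ∀ a, (labelGraph l).Reachable r a := fun a =>
    ⟨(exists_walk_up hl hT (by simp [hr])).choose⟩
  have : Nonempty V := ⟨r⟩
  refine ⟨⟨fun a b => (hreach a).symm.trans (hreach b)⟩, ?_⟩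
  rw [isAcyclic_iff_forall_adj_isBridge]
  have main : ∀ u v, (∃ k, l v = l u ++ [k]) → (labelGraph l).IsBridge s(u, v) := by
    rintro u v ⟨k, hk⟩
    rw [isBridge_iff_forall_walk_mem_edges]
    intro p
    obtain ⟨d, hd, rfl, j, hj⟩ := exists_dart hl (fun h => by
      rw [hk] at h
      exact not_append_prefix h List.prefix_rfl) List.prefix_rfl p
    have : l u = l d.fst := (List.append_inj' (hk.symm.trans hj) rfl).1
    obtain rfl := hl this
    exact List.mem_map.2 ⟨d, hd, rfl⟩
  intro u v huv
  rcases huv with h | h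
  · exact main u v h
  · rw [Sym2.eq_swap]
    exact main v u h

end

/-- There is no infinite strictly increasing sequence of nodes. -/
def Rayless (T : Set (List ℕ)) : Prop :=
  ¬ ∃ z : ℕ → List ℕ, ∀ k, z k ∈ T ∧ z k <+: z (k + 1) ∧ z k ≠ z (k + 1)

/-- The tree with the given trees above its root. -/
def join (A : ℕ → Set (List ℕ)) : Set (List ℕ) := {z | z = [] ∨ ∃ n, ∃ p ∈ A n, z = n :: p}

theorem isTr_join {A : ℕ → Set (List ℕ)} (hA : ∀ n, A n = ∅ ∨ IsTr (A n)) : IsTr (join A) := by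
  refine ⟨Or.inl rfl, fun x y h => ?_⟩
  rcases x with _ | ⟨n, x⟩
  · exact Or.inl rfl
  · rcases h with h | ⟨n', p, hp, h⟩
    · simp at h
    · rw [List.cons_append, List.cons.injEq] at h
      obtain ⟨rfl, rfl⟩ := h
      have : A n ≠ ∅ := fun h => by simp [h] at hp
      exact Or.inr ⟨n, x, ((hA n).resolve_left this).prefix_mem x y hp, rfl⟩

theorem rayless_join {A : ℕ → Set (List ℕ)} (hA : ∀ n, Rayless (A n)) : Rayless (join A) := by
  rintro ⟨z, hz⟩
  have hne : ∀ k, z (k + 1) ≠ [] := by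
    intro k h
    have := (hz k).2
    rw [h] at this
    exact this.2 (List.prefix_nil.1 this.1)
  have hex : ∀ k, ∃ n, ∃ p ∈ A n, z (k + 1) = n :: p := fun k => (hz (k + 1)).1.resolve_left (hne k)
  choose n p hp hzp using hex
  have hstep : ∀ k, n k = n (k + 1) ∧ p k <+: p (k + 1) ∧ p k ≠ p (k + 1) := by
    intro k
    have h := (hz (k + 1)).2
    rw [hzp k, hzp (k + 1), List.cons_prefix_cons] at h
    exact ⟨h.1.1, h.1.2, fun he => h.2 (by rw [h.1.1, he])⟩
  have hn : ∀ k, n k = n 0 := by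
    intro k
    induction k with
    | zero => rfl
    | succ k ih => rw [← (hstep k).1, ih]
  exact hA (n 0) ⟨p, fun k => ⟨hn k ▸ hp k, (hstep k).2⟩⟩

theorem Rayless.eq_nil_of_map {T : Set (List ℕ)} (hT : Rayless T) (hnil : [] ∈ T) (f : T → T)
    (hf : f.Injective) (hmono : ∀ x y : T, x.1 <+: y.1 → (f x).1 <+: (f y).1) :
    (f ⟨[], hnil⟩).1 = [] := by
  by_contra hne
  refine hT ⟨fun k => (f^[k] ⟨[], hnil⟩).1, fun k => ⟨Subtype.coe_prop _, ?_, fun h => hne ?_⟩⟩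
  · induction k with
    | zero => simp
    | succ k ih =>
      dsimp only at ih ⊢
      rw [Function.iterate_succ_apply', Function.iterate_succ_apply' f (k + 1)]
      exact hmono _ _ ih
  · dsimp only at h
    rw [Function.iterate_succ_apply] at h
    exact congrArg Subtype.val (hf.iterate k (Subtype.ext h)).symm

theorem not_btwLE_join {V W : Type*} {A : ℕ → Set (List ℕ)} (hA : ∀ n, A n = ∅ ∨ IsTr (A n))
    (hR : ∀ n, Rayless (A n)) {l : V → List ℕ} (hl : l.Injective)
    (hlr : Set.range l = join fun _ => join A) {n : ℕ} {l' : W → List ℕ} (hl' : l'.Injective)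
    (hlr' : Set.range l' = A n) : ¬ BtwLE (labelGraph l) (labelGraph l') := by
  rintro ⟨φ, hφ, hb⟩
  have hJ := isTr_join hA
  have hT : IsTr (Set.range l) := hlr ▸ isTr_join fun _ => Or.inr hJ
  obtain ⟨r, hr⟩ := hT.nil_mem
  have hT' : IsTr (Set.range l') := by
    rw [hlr']
    refine (hA n).resolve_left fun h => ?_
    have : l' (φ r) ∈ A n := hlr' ▸ ⟨_, rfl⟩
    simp [h] at this
  have hi : ∃ i, ∀ a, [i] <+: l a → l' (φ r) <+: l' (φ a) := by
    by_contra! hcon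
    obtain ⟨a, ha, hna⟩ := hcon 0
    obtain ⟨c, hc, hnc⟩ := hcon 1
    rcases (hb _ _ _ (btw_root hl hr zero_ne_one ha hc hT)).prefix_or_prefix hl' hT' with h | h
    · exact hna h
    · exact hnc h
  obtain ⟨i, hi⟩ := hi
  have hmono : ∀ a b, [i] <+: l a → l a <+: l b → l' (φ a) <+: l' (φ b) := fun a b ha hab =>
    (hb r a b (btw_of_prefix hl (by simp [hr]) hab)).prefix_of_prefix hl' hT' (hi b (ha.trans hab))
  have hex : ∀ z : join A, ∃ a, l a = i :: z.1 := fun z => by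
    have : i :: z.1 ∈ Set.range l := hlr ▸ Or.inr ⟨i, z.1, z.2, rfl⟩
    exact this
  choose g hg using hex
  have hmem : ∀ z, n :: l' (φ (g z)) ∈ join A := fun z => Or.inr ⟨n, _, hlr' ▸ ⟨_, rfl⟩, rfl⟩
  have := (rayless_join hR).eq_nil_of_map hJ.nil_mem (fun z => ⟨_, hmem z⟩) (fun z w h => ?_)
    fun z w h => ?_
  · simp at this
  · have h := hφ (hl' (List.cons.inj (Subtype.ext_iff.1 h)).2)
    have := hg z
    rw [h, hg w] at this
    exact Subtype.ext (List.cons.inj this).2.symm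
  · rw [List.cons_prefix_cons]
    exact ⟨rfl, hmono _ _ (by simp [hg]) (by simpa [hg] using h)⟩

theorem not_countable_types :
    ¬ Countable (Quot fun (T S : {G : SimpleGraph ℕ // G.IsTree}) => TopEquiv T.1 S.1) := by
  classical
  intro hc
  obtain ⟨f, hf⟩ := hc.exists_injective_nat
  have hB : ∀ T S : {G : SimpleGraph ℕ // G.IsTree},
      Quot.mk (fun (T S : {G : SimpleGraph ℕ // G.IsTree}) => TopEquiv T.1 S.1) T = Quot.mk _ S →
      BtwLE T.1 S.1 := by
    intro T S h
    have : BtwLE T.1 S.1 ∧ BtwLE S.1 T.1 := by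
      replace h := Quot.eqvGen_exact h
      induction h with
      | rel T S h =>
        exact ⟨btwLE_of_topMinorLE T.2 S.2 h.1, btwLE_of_topMinorLE S.2 T.2 h.2⟩
      | refl T => exact ⟨.refl _, .refl _⟩
      | symm T S _ ih => exact ih.symm
      | trans T S U _ _ ih ih' => exact ⟨ih.1.trans ih'.1, ih'.2.trans ih.2⟩
    exact this.1
  let P : ℕ → Set (List ℕ) → Prop := fun n T => IsTr T ∧ Rayless T ∧
    ∃ l : ℕ → List ℕ, l.Injective ∧ Set.range l = T ∧ ∃ h : (labelGraph l).IsTree,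
      f (Quot.mk _ ⟨labelGraph l, h⟩) = n
  let A : ℕ → Set (List ℕ) := fun n => if h : ∃ T, P n T then h.choose else ∅
  have hA : ∀ n, (∃ T, P n T) → P n (A n) := fun n h => by
    simp only [A, dif_pos h]
    exact h.choose_spec
  have hA0 : ∀ n, ¬ (∃ T, P n T) → A n = ∅ := fun n h => by simp only [A, dif_neg h]
  have hA1 : ∀ n, A n = ∅ ∨ IsTr (A n) := fun n => by
    by_cases h : ∃ T, P n T
    · exact Or.inr (hA n h).1
    · exact Or.inl (hA0 n h)
  have hA2 : ∀ n, Rayless (A n) := fun n => by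
    by_cases h : ∃ T, P n T
    · exact (hA n h).2.1
    · rw [hA0 n h]
      rintro ⟨z, hz⟩
      exact (hz 0).1
  have hJ := isTr_join hA1
  let J := join fun _ => join A
  have hinf : Infinite J := by
    refine Infinite.of_injective (fun k : ℕ => (⟨[k], Or.inr ⟨k, [], hJ.nil_mem, rfl⟩⟩ : J)) ?_
    intro k k' h
    exact (List.cons.inj (Subtype.ext_iff.1 h)).1
  obtain ⟨e⟩ := nonempty_equiv_of_countable (α := ℕ) (β := J)
  have hl : Function.Injective fun k => (e k).1 := Subtype.val_injective.comp e.injective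
  have hlr : (Set.range fun k => (e k).1) = J := by
    ext z
    exact ⟨by rintro ⟨k, rfl⟩; exact (e k).2, fun hz => ⟨e.symm ⟨z, hz⟩, by simp⟩⟩
  have hJT : IsTr J := isTr_join fun _ => Or.inr hJ
  have htree := isTree_labelGraph hl (by rw [hlr]; exact hJT)
  obtain ⟨-, -, l', hl', hlr', htree', hn⟩ := hA (f (Quot.mk _ ⟨_, htree⟩))
    ⟨J, hJT, rayless_join fun _ => rayless_join hA2, _, hl, hlr, htree, rfl⟩
  exact not_btwLE_join hA1 hA2 hl hlr hl' hlr' (hB _ _ (hf hn).symm)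

end TreeCode

open Ordinal Cardinal in
theorem Cardinal.mk_option_Iio_omega_one_prod_nat :
    #(Option (Set.Iio (ω₁ : Ordinal.{0}) × ℕ)) = ℵ₁ := by
  have hle : ℵ₀ ≤ (ℵ₁ : Cardinal.{1}) := aleph0_le_aleph 1
  have h : #(Set.Iio (ω₁ : Ordinal.{0})) = ℵ₁ := by
    rw [Cardinal.mk_Iio_ordinal, Ordinal.card_omega, lift_aleph, Ordinal.lift_one]
  rw [mk_option, mk_prod, h, mk_nat, lift_aleph0, Cardinal.lift_uzero,
    mul_eq_left hle hle aleph0_ne_zero, add_one_eq hle]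

/-- The number of topological types of countable trees is exactly `ℵ₁`: the quotient of
the set of trees with vertex set `ℕ` by the equivalence `≡` (same topological type)
has cardinality `ℵ₁`. -/
theorem number_of_topological_types_of_countable_trees :
    Cardinal.mk (Quot fun (T S : {G : SimpleGraph ℕ // G.IsTree}) => TopEquiv T.1 S.1) =
      Cardinal.aleph 1 := by
  refine le_antisymm ?_ ?_
  · obtain ⟨F, hF⟩ := TreeCode.exists_tree_key
    have hinj : Function.Injective fun
        q : Quot fun (T S : {G : SimpleGraph ℕ // G.IsTree}) => TopEquiv T.1 S.1 =>
        F (TreeCode.paths q.out.1) := fun q r h => by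
      rw [← Quot.out_eq q, ← Quot.out_eq r]
      exact Quot.sound
        ⟨TreeCode.topMinorLE_of_emb_paths q.out.2 r.out.2
          (hF _ _ (TreeCode.isTr_paths _) (TreeCode.isTr_paths _) h),
        TreeCode.topMinorLE_of_emb_paths r.out.2 q.out.2
          (hF _ _ (TreeCode.isTr_paths _) (TreeCode.isTr_paths _) h.symm)⟩
    have h := Cardinal.lift_mk_le_lift_mk_of_injective hinj
    rw [Cardinal.mk_option_Iio_omega_one_prod_nat] at h
    simpa using h
  · by_contra h
    exact TreeCode.not_countable_types
      (Cardinal.mk_le_aleph0_iff.1 (Cardinal.lt_aleph_one_iff.1 (not_le.1 h)))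
end

section
/- For every infinite cardinal κ and every ordinal α with 0 < α < κ⁺, there exists a rayless tree of size κ whose Schmidt rank is exactly α. -/
universe u v

/-- `G` contains a ray (a one-way infinite path) as a subgraph. -/
def HasRay {V : Type u} (G : SimpleGraph V) : Prop :=
  ∃ f : ℕ → V, Function.Injective f ∧ ∀ n, G.Adj (f n) (f (n + 1))

/-- `G` is rayless: it contains no ray as a subgraph. -/
def Rayless {V : Type u} (G : SimpleGraph V) : Prop := ¬ HasRay G

/-- Graphs (on vertex types in universe `u`), bundled with their vertex type. -/
def GraphSig := Σ V : Type u, SimpleGraph V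

/-- `HasSchmidtRankAux α ⟨V, G⟩` holds iff the graph `G` has Schmidt rank `α`:
`G` has rank `0` iff it is finite, and for `α > 0`, `G` has rank `α` iff it has no
rank `< α` and there is a finite vertex set `X` such that every connected component
of `G - X` has some rank `< α`.  (For `α = 0` the clause below is equivalent to
finiteness of `G`, since no ordinal is `< 0`.) -/
def HasSchmidtRankAux : Ordinal.{u} → GraphSig.{u} → Prop :=
  WellFounded.fix Ordinal.lt_wf fun α ih p =>
    (∀ β (hβ : β < α), ¬ ih β hβ p) ∧
    ∃ X : Set p.1, X.Finite ∧
      ∀ C : (p.2.induce Xᶜ).ConnectedComponent,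
        ∃ β, ∃ hβ : β < α, ih β hβ ⟨C.supp, (p.2.induce Xᶜ).induce C.supp⟩

/-- The graph `G` has Schmidt rank `α`. -/
def HasSchmidtRank {V : Type u} (G : SimpleGraph V) (α : Ordinal.{u}) : Prop :=
  HasSchmidtRankAux α ⟨V, G⟩

open SimpleGraph

theorem hasSchmidtRank_iff {V : Type u} (G : SimpleGraph V) (α : Ordinal.{u}) :
    HasSchmidtRank G α ↔ (∀ β < α, ¬ HasSchmidtRank G β) ∧
      ∃ X : Set V, X.Finite ∧ ∀ C : (G.induce Xᶜ).ConnectedComponent,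
        ∃ β < α, HasSchmidtRank C.toSimpleGraph β := by
  unfold HasSchmidtRank
  conv_lhs => rw [HasSchmidtRankAux, WellFounded.fix_eq]
  simp only [exists_prop]
  rfl

theorem HasSchmidtRank.eq {V : Type u} {G : SimpleGraph V} {α β : Ordinal.{u}}
    (hα : HasSchmidtRank G α) (hβ : HasSchmidtRank G β) : α = β :=
  le_antisymm
    (not_lt.1 fun h => ((hasSchmidtRank_iff G α).1 hα).1 β h hβ)
    (not_lt.1 fun h => ((hasSchmidtRank_iff G β).1 hβ).1 α h hα)

theorem exists_le_hasSchmidtRank_iff {V : Type u} (G : SimpleGraph V) (α : Ordinal.{u}) :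
    (∃ β ≤ α, HasSchmidtRank G β) ↔
      ∃ X : Set V, X.Finite ∧ ∀ C : (G.induce Xᶜ).ConnectedComponent,
        ∃ β < α, HasSchmidtRank C.toSimpleGraph β := by
  constructor
  · rintro ⟨β, hβ, h⟩
    obtain ⟨-, X, hX, hC⟩ := (hasSchmidtRank_iff G β).1 h
    refine ⟨X, hX, fun C => ?_⟩
    obtain ⟨γ, hγ, h⟩ := hC C
    exact ⟨γ, hγ.trans_le hβ, h⟩
  · intro h
    by_cases hlt : ∃ β < α, HasSchmidtRank G β
    · obtain ⟨β, hβ, h⟩ := hlt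
      exact ⟨β, hβ.le, h⟩
    · push Not at hlt
      exact ⟨α, le_rfl, (hasSchmidtRank_iff G α).2 ⟨hlt, h⟩⟩

/-- A connected subgraph lies in a connected component. -/
theorem SimpleGraph.Connected.exists_isContained_toSimpleGraph {V : Type u} {W : Type v}
    {G : SimpleGraph V} {H : SimpleGraph W} (hG : G.Connected) (h : G ⊑ H) :
    ∃ C : H.ConnectedComponent, G ⊑ C.toSimpleGraph := by
  obtain ⟨f⟩ := h
  obtain ⟨v⟩ := hG.nonempty
  refine ⟨H.connectedComponentMk (f v), ⟨⟨⟨fun w => ⟨f w, ?_⟩, ?_⟩, ?_⟩⟩⟩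
  · exact ConnectedComponent.sound ((hG.preconnected w v).map f.toHom)
  · intro a b hab
    exact f.toHom.map_adj hab
  · intro a b hab
    exact f.injective (congrArg Subtype.val hab)

theorem SimpleGraph.Copy.isContained_induce {V : Type u} {W : Type v}
    {G : SimpleGraph V} {H : SimpleGraph W} (f : Copy G H) {s : Set W} (hf : ∀ v, f v ∈ s) :
    G ⊑ H.induce s :=
  ⟨⟨⟨fun v => ⟨f v, hf v⟩, fun hab => f.toHom.map_adj hab⟩,
    fun _ _ hab => f.injective (congrArg Subtype.val hab)⟩⟩

/-- The Schmidt rank is monotone under taking subgraphs. -/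
theorem SimpleGraph.IsContained.exists_le_hasSchmidtRank {α : Ordinal.{u}} :
    ∀ {V W : Type u} {G : SimpleGraph V} {H : SimpleGraph W}, G ⊑ H →
      HasSchmidtRank H α → ∃ β ≤ α, HasSchmidtRank G β := by
  induction α using WellFoundedLT.induction with
  | ind α ih =>
    rintro V W G H ⟨f⟩ hH
    obtain ⟨-, X, hX, hC⟩ := (hasSchmidtRank_iff H α).1 hH
    refine (exists_le_hasSchmidtRank_iff G α).2
      ⟨f ⁻¹' X, hX.preimage f.injective.injOn, fun C => ?_⟩
    have hCH : C.toSimpleGraph ⊑ H.induce Xᶜ :=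
      Copy.isContained_induce (f.comp ((Copy.induce G _).comp (Copy.induce _ C.supp)))
        fun v => v.1.2
    obtain ⟨D, hD⟩ := C.connected_toSimpleGraph.exists_isContained_toSimpleGraph hCH
    obtain ⟨β, hβ, h⟩ := hC D
    obtain ⟨γ, hγ, h⟩ := ih β hβ hD h
    exact ⟨γ, hγ.trans_lt hβ, h⟩

theorem HasSchmidtRank.rayless {α : Ordinal.{u}} :
    ∀ {V : Type u} {G : SimpleGraph V}, HasSchmidtRank G α → Rayless G := by
  induction α using WellFoundedLT.induction with
  | ind α ih =>
    rintro V G hG ⟨f, hf, hadj⟩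
    obtain ⟨-, X, hX, hC⟩ := (hasSchmidtRank_iff G α).1 hG
    obtain ⟨N, hN⟩ := (hX.preimage hf.injOn).bddAbove
    have hray : hasse ℕ ⊑ G.induce Xᶜ := by
      refine Copy.isContained_induce (s := Xᶜ)
        ⟨⟨fun n => f (n + (N + 1)), ?_⟩, fun a b hab => ?_⟩ fun n hn => ?_
      · intro a b hab
        rw [hasse_adj, Nat.covBy_iff_add_one_eq, Nat.covBy_iff_add_one_eq] at hab
        rcases hab with rfl | rfl
        · have := hadj (a + (N + 1))
          rwa [Nat.add_right_comm] at this
        · have := (hadj (b + (N + 1))).symm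
          rwa [Nat.add_right_comm] at this
      · simpa using hf hab
      · have : n + (N + 1) ≤ N := hN hn
        omega
    obtain ⟨C, ⟨g⟩⟩ := (Connected.mk
      (hasse_preconnected_of_succ ℕ)).exists_isContained_toSimpleGraph hray
    obtain ⟨β, hβ, h⟩ := hC C
    refine ih β hβ h ⟨g, g.injective, fun n => g.toHom.map_adj ?_⟩
    simp [hasse_adj, Nat.covBy_iff_add_one_eq]

section RootJoin

variable {ι : Type u} {V : ι → Type u}

/-- The adjacency relation of `rootJoin`. -/
inductive RootJoinAdj (G : ∀ i, SimpleGraph (V i)) (r : ∀ i, V i) :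
    Option (Σ i, V i) → Option (Σ i, V i) → Prop
  | root_left (i : ι) : RootJoinAdj G r none (some ⟨i, r i⟩)
  | root_right (i : ι) : RootJoinAdj G r (some ⟨i, r i⟩) none
  | inner (i : ι) (x y : V i) (h : (G i).Adj x y) : RootJoinAdj G r (some ⟨i, x⟩) (some ⟨i, y⟩)

theorem RootJoinAdj.of_some {G : ∀ i, SimpleGraph (V i)} {r : ∀ i, V i} {i : ι} {x y : V i}
    (h : RootJoinAdj G r (some ⟨i, x⟩) (some ⟨i, y⟩)) : (G i).Adj x y := by
  cases h with
  | inner _ _ _ h => exact h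

/-- The disjoint union of the rooted graphs `(G i, r i)` together with a new vertex `none`
joined to every root `r i`. -/
def rootJoin (G : ∀ i, SimpleGraph (V i)) (r : ∀ i, V i) : SimpleGraph (Option (Σ i, V i)) where
  Adj := RootJoinAdj G r
  symm := ⟨by
    rintro _ _ (i | i | ⟨i, x, y, h⟩)
    · exact .root_right i
    · exact .root_left i
    · exact .inner i y x h.symm⟩
  loopless := ⟨by
    rintro (_ | ⟨i, x⟩) h
    · cases h
    · exact h.of_some.ne rfl⟩

variable (G : ∀ i, SimpleGraph (V i)) (r : ∀ i, V i)

/-- The copy of `G i` in `rootJoin G r`. -/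
def rootJoinCopy (i : ι) : Copy (G i) (rootJoin G r) :=
  ⟨⟨fun x => some ⟨i, x⟩, fun {x y} h => RootJoinAdj.inner i x y h⟩,
    fun x y h => by
      have h : (some ⟨i, x⟩ : Option (Σ i, V i)) = some ⟨i, y⟩ := h
      simpa using h⟩

theorem rootJoin_connected (hG : ∀ i, (G i).Connected) : (rootJoin G r).Connected := by
  rw [connected_iff_exists_forall_reachable]
  refine ⟨none, ?_⟩
  rintro (_ | ⟨i, x⟩)
  · rfl
  · exact (show (rootJoin G r).Adj none (some ⟨i, r i⟩) from .root_left i).reachable.trans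
      (((hG i).preconnected (r i) x).map (rootJoinCopy G r i).toHom)

theorem rootJoin_isBridge_root (i : ι) : (rootJoin G r).IsBridge s(some ⟨i, r i⟩, none) := by
  rw [isBridge_iff, reachable_iff_reflTransGen]
  intro h
  have key : ∀ w, Relation.ReflTransGen
      ((rootJoin G r).deleteEdges {s(some ⟨i, r i⟩, none)}).Adj (some ⟨i, r i⟩) w →
      ∃ x, w = some ⟨i, x⟩ := by
    intro w hw
    induction hw with
    | refl => exact ⟨_, rfl⟩
    | tail _ hadj ih =>
      obtain ⟨x, rfl⟩ := ih
      rw [deleteEdges_adj] at hadj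
      obtain ⟨hadj, hne⟩ := hadj
      cases hadj with
      | root_right => exact absurd rfl hne
      | inner _ _ y h => exact ⟨y, rfl⟩
  obtain ⟨x, hx⟩ := key _ h
  cases hx

theorem rootJoin_isBridge_inner {i : ι} {x y : V i} (h : (G i).IsBridge s(x, y)) :
    (rootJoin G r).IsBridge s(some ⟨i, x⟩, some ⟨i, y⟩) := by
  rw [isBridge_iff, reachable_iff_reflTransGen]
  intro hr
  have key : ∀ w, Relation.ReflTransGen
      ((rootJoin G r).deleteEdges {s(some ⟨i, x⟩, some ⟨i, y⟩)}).Adj (some ⟨i, x⟩) w →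
      (∀ z, w = some ⟨i, z⟩ → ((G i).deleteEdges {s(x, y)}).Reachable x z) ∧
      ((∀ z, w ≠ some ⟨i, z⟩) → ((G i).deleteEdges {s(x, y)}).Reachable x (r i)) := by
    intro w hw
    induction hw with
    | refl =>
      refine ⟨fun z hz => ?_, fun hz => absurd rfl (hz x)⟩
      cases hz
      rfl
    | tail _ hadj ih =>
      rw [deleteEdges_adj] at hadj
      obtain ⟨hadj, hne⟩ := hadj
      cases hadj with
      | root_left j =>
        have hx := ih.2 (by simp)
        refine ⟨fun z hz => ?_, fun _ => hx⟩
        cases hz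
        exact hx
      | root_right j =>
        refine ⟨fun z hz => by simp at hz, fun _ => ?_⟩
        by_cases hj : j = i
        · subst hj
          exact ih.1 _ rfl
        · exact ih.2 fun z hz => hj (by cases hz; rfl)
      | inner j a b hab =>
        by_cases hj : j = i
        · subst hj
          refine ⟨fun z hz => ?_, fun hz => absurd rfl (hz b)⟩
          cases hz
          refine (ih.1 a rfl).trans (Adj.reachable ?_)
          rw [deleteEdges_adj]
          refine ⟨hab, fun he => hne ?_⟩
          have := congrArg (Sym2.map fun z => (some ⟨j, z⟩ : Option (Σ i, V i)))
            (Set.mem_singleton_iff.1 he)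
          simpa only [Sym2.map_mk, Set.mem_singleton_iff] using this
        · exact ⟨fun z hz => absurd (by cases hz; rfl) hj,
            fun _ => ih.2 fun z hz => hj (by cases hz; rfl)⟩
  exact isBridge_iff.1 h ((key _ hr).1 y rfl)

theorem rootJoin_isTree (hG : ∀ i, (G i).IsTree) : (rootJoin G r).IsTree := by
  refine ⟨rootJoin_connected G r fun i => (hG i).connected, ?_⟩
  rw [isAcyclic_iff_forall_adj_isBridge]
  rintro _ _ (i | i | ⟨i, x, y, h⟩)
  · rw [Sym2.eq_swap]
    exact rootJoin_isBridge_root G r i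
  · exact rootJoin_isBridge_root G r i
  · exact rootJoin_isBridge_inner G r (isAcyclic_iff_forall_adj_isBridge.1 (hG i).isAcyclic h)

theorem rootJoin_component_isContained
    (C : ((rootJoin G r).induce {none}ᶜ).ConnectedComponent) :
    ∃ i, C.toSimpleGraph ⊑ G i := by
  obtain ⟨⟨v, hv⟩, hvC⟩ := C.nonempty_supp
  rcases v with _ | ⟨i, x⟩
  · exact absurd rfl hv
  have key : ∀ w, Relation.ReflTransGen ((rootJoin G r).induce {none}ᶜ).Adj
      ⟨some ⟨i, x⟩, hv⟩ w → ∃ y, w.1 = some ⟨i, y⟩ := by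
    intro w hw
    induction hw with
    | refl => exact ⟨_, rfl⟩
    | @tail b c _ hadj ih =>
      obtain ⟨y, hy⟩ := ih
      obtain ⟨c, hc⟩ := c
      have hadj : RootJoinAdj G r b.1 c := hadj
      rw [hy] at hadj
      cases hadj with
      | root_right => exact absurd rfl hc
      | inner _ _ z h => exact ⟨z, rfl⟩
  have hsupp (w : C.supp) : ∃ y, w.1.1 = some ⟨i, y⟩ :=
    key w.1 ((reachable_iff_reflTransGen _ _).1 (C.reachable_of_mem_supp hvC w.2))
  choose g hg using hsupp
  refine ⟨i, ⟨⟨⟨g, fun {a b} hab => ?_⟩, fun a b hab => ?_⟩⟩⟩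
  · have hab : RootJoinAdj G r a.1.1 b.1.1 := hab
    rw [hg, hg] at hab
    exact hab.of_some
  · refine Subtype.ext (Subtype.ext ?_)
    rw [hg, hg, show g a = g b from hab]

/-- If every rank below `α` is attained infinitely often among connected graphs `G i`, and no
other ranks occur, then `rootJoin G r` has rank `α`. -/
theorem rootJoin_hasSchmidtRank {α : Ordinal.{u}} (hG : ∀ i, (G i).Connected)
    (hlt : ∀ i, ∃ β < α, HasSchmidtRank (G i) β)
    (hinf : ∀ β < α, {i | HasSchmidtRank (G i) β}.Infinite) :
    HasSchmidtRank (rootJoin G r) α := by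
  refine (hasSchmidtRank_iff _ _).2 ⟨fun γ hγ h => ?_, {none}, Set.finite_singleton _, fun C => ?_⟩
  · obtain ⟨-, X, hX, hC⟩ := (hasSchmidtRank_iff _ _).1 h
    have hfin : {i | ∃ x, some ⟨i, x⟩ ∈ X}.Finite := by
      refine ((hX.preimage (Option.some_injective _).injOn).image Sigma.fst).subset ?_
      rintro i ⟨x, hx⟩
      exact ⟨⟨i, x⟩, hx, rfl⟩
    obtain ⟨i, hi, hiX⟩ := (hinf γ hγ).exists_notMem_finite hfin
    have hcont : G i ⊑ (rootJoin G r).induce Xᶜ :=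
      (rootJoinCopy G r i).isContained_induce fun x hx => hiX ⟨x, hx⟩
    obtain ⟨C, hGC⟩ := (hG i).exists_isContained_toSimpleGraph hcont
    obtain ⟨β, hβ, h⟩ := hC C
    obtain ⟨δ, hδ, h⟩ := hGC.exists_le_hasSchmidtRank h
    exact (hδ.trans_lt hβ).ne (h.eq hi)
  · obtain ⟨i, hi⟩ := rootJoin_component_isContained G r C
    obtain ⟨β, hβ, h⟩ := hlt i
    obtain ⟨γ, hγ, h⟩ := hi.exists_le_hasSchmidtRank h
    exact ⟨γ, hγ.trans_lt hβ, h⟩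

end RootJoin

open Cardinal in
theorem exists_tree_hasSchmidtRank_mk_le {κ : Cardinal.{u}} (hκ : ℵ₀ ≤ κ) (α : Ordinal.{u})
    (hα : α.card ≤ κ) :
    ∃ (V : Type u) (G : SimpleGraph V),
      G.IsTree ∧ #V ≤ κ ∧ (0 < α → κ ≤ #V) ∧ HasSchmidtRank G α := by
  induction α using WellFoundedLT.induction with
  | ind α ih =>
    have ih' (β : α.ToType) : ∃ (V : Type u) (G : SimpleGraph V),
        G.IsTree ∧ #V ≤ κ ∧ HasSchmidtRank G β.toOrd := by
      obtain ⟨V, G, hG, hV, -, h⟩ := ih β.toOrd β.toOrd.2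
        ((Ordinal.card_le_card (le_of_lt β.toOrd.2)).trans hα)
      exact ⟨V, G, hG, hV, h⟩
    choose V G hG hV hrank using ih'
    have r (β : α.ToType) : V β := (hG β).connected.nonempty.some
    have hinf : Infinite κ.out := infinite_iff.2 (by simpa using hκ)
    refine ⟨_, rootJoin (ι := α.ToType × κ.out) (fun i => G i.1) (fun i => r i.1),
      rootJoin_isTree _ _ fun i => hG i.1, ?_, fun h0 => ?_,
      rootJoin_hasSchmidtRank _ _ (fun i => (hG i.1).connected)
        (fun i => ⟨_, i.1.toOrd.2, hrank i.1⟩) fun β hβ => ?_⟩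
    · rw [mk_option, mk_sigma]
      refine add_le_of_le hκ ?_ (one_le_aleph0.trans hκ)
      calc sum (fun i : α.ToType × κ.out => #(V i.1))
          ≤ sum (fun _ : α.ToType × κ.out => κ) := sum_le_sum _ _ fun i => hV i.1
        _ = α.card * κ * κ := by simp
        _ ≤ κ * κ * κ := by gcongr
        _ = κ := by rw [mul_eq_self hκ, mul_eq_self hκ]
    · let β : α.ToType := Ordinal.ToType.mk ⟨0, h0⟩
      conv_lhs => rw [← mk_out κ]
      refine mk_le_of_injective (f := fun k => some ⟨(β, k), r β⟩) fun a b hab => ?_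
      simpa using hab
    · refine Set.infinite_of_injective_forall_mem
        (f := fun k : κ.out => (Ordinal.ToType.mk ⟨β, hβ⟩, k)) (fun a b hab => ?_) fun k => ?_
      · simpa using hab
      · simpa using hrank (Ordinal.ToType.mk ⟨β, hβ⟩)

/-- For every infinite cardinal `κ` and every ordinal `α` with `0 < α < κ⁺`, there exists
a rayless tree of size `κ` whose Schmidt rank is exactly `α`. -/
theorem exists_rayless_tree_of_schmidt_rank (κ : Cardinal.{u}) (hκ : Cardinal.aleph0 ≤ κ)
    (α : Ordinal.{u}) (hα0 : 0 < α) (hα : α < (Order.succ κ).ord) :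
    ∃ (V : Type u) (G : SimpleGraph V),
      G.IsTree ∧ Rayless G ∧ Cardinal.mk V = κ ∧ HasSchmidtRank G α := by
  obtain ⟨V, G, hG, hle, hge, h⟩ := exists_tree_hasSchmidtRank_mk_le hκ α
    (Order.lt_succ_iff.1 (Cardinal.lt_ord.1 hα))
  exact ⟨V, G, hG, h.rayless, hle.antisymm (hge hα0), h⟩
end
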